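/- arXiv:1807.10315 — 12 statements merged into one kernel-verified Lean document; each statement's English description precedes it below -/
import Mathlib

section
/- Suppose that for every M ≥ 0 there exists T^▲ = T^▲(M) > 0 such that: (i) for every ε > 0 there exists δ = δ(ε) > 0 (independent of M) such that every solution of x_{k+1} = F̄(x_k, d_k, T_k) with |x_0| ≤ min{δ, M}, {T_i} ∈ Φ(T^▲) and {d_i} ∈ 𝒟 satisfies |x_k| ≤ ε for all k ∈ ℕ₀; (ii) for every L ≥ 0 there exists C = C(M,L) ≥ 0 such that every solution with |x_0| ≤ M, {T_i} ∈ Φ(T^▲) and {d_i} ∈ 𝒟 satisfies |x_k| ≤ C for all k with Σ_{i=0}^{k-1} T_i ≤ L; (iii) for every ε > 0 there exists 𝒯 = 𝒯(M,ε) ≥ 0 such that every solution with |x_0| ≤ M, {T_i} ∈ Φ(T^▲) and {d_i} ∈ 𝒟 satisfies |x_k| ≤ ε for all k with Σ_{i=0}^{k-1} T_i ≥ 𝒯. Then the system x_{k+1} = F̄(x_k, d_k, T_k) is RSS-VSR. -/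
open scoped BigOperators

/-- A class-`K` function: continuous, strictly increasing on `[0,∞)` and zero at zero. -/
def ClassK (f : ℝ → ℝ) : Prop :=
  ContinuousOn f (Set.Ici 0) ∧ StrictMonoOn f (Set.Ici 0) ∧ f 0 = 0

/-- A class-`K∞` function: class `K` and unbounded. -/
def ClassKInf (f : ℝ → ℝ) : Prop :=
  ClassK f ∧ Filter.Tendsto f Filter.atTop Filter.atTop

/-- A class-`KL` function. -/
def ClassKL (β : ℝ → ℝ → ℝ) : Prop :=
  (∀ t, 0 ≤ t → ContinuousOn (fun s => β s t) (Set.Ici 0) ∧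
      StrictMonoOn (fun s => β s t) (Set.Ici 0) ∧ β 0 t = 0) ∧
  (∀ s, 0 < s → StrictAntiOn (fun t => β s t) (Set.Ici 0) ∧
      Filter.Tendsto (fun t => β s t) Filter.atTop (nhds 0))

/-- Robust semiglobal stability under varying sampling rate (RSS-VSR) of
`x_{k+1} = F (x_k) (d_k) (T_k)` with disturbance bound `D`. -/
def RSSVSR {X P : Type*} [NormedAddCommGroup X] [NormedAddCommGroup P]
    (F : X → P → ℝ → X) (D : ℝ) : Prop :=
  ∃ β : ℝ → ℝ → ℝ, ClassKL β ∧
    ∀ M, 0 ≤ M → ∃ Tmax, 0 < Tmax ∧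
      ∀ (x : ℕ → X) (d : ℕ → P) (T : ℕ → ℝ),
        (∀ k, x (k + 1) = F (x k) (d k) (T k)) →
        ‖x 0‖ ≤ M → (∀ i, 0 < T i ∧ T i < Tmax) → (∀ i, ‖d i‖ ≤ D) →
        ∀ k, ‖x k‖ ≤ β ‖x 0‖ (∑ i ∈ Finset.range k, T i)

theorem kl_of_mono (G : ℝ → ℝ → ℝ) (h0 : ∀ s t, 0 ≤ G s t)
    (hm : ∀ t, Monotone (fun s => G s t)) (ha : ∀ s, Antitone (G s))
    (hs : ∀ ε, 0 < ε → ∃ δ, 0 < δ ∧ ∀ t, 0 ≤ t → G δ t ≤ ε)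
    (ht : ∀ s ε, 0 < ε → ∃ τ, G s τ ≤ ε) :
    ∃ β : ℝ → ℝ → ℝ, ClassKL β ∧ ∀ s t, 0 ≤ s → 0 ≤ t → G s t ≤ β s t := by
  have hint : ∀ t a b, IntervalIntegrable (fun s => G s t) MeasureTheory.volume a b :=
    fun t a b => (hm t).intervalIntegrable
  have hmu : ∀ s t, 0 ≤ s → Monotone (fun u => G (s * u) t) := fun s t h u v huv =>
    hm t (mul_le_mul_of_nonneg_left huv h)
  have hintu : ∀ s t a b, 0 ≤ s →
      IntervalIntegrable (fun u => G (s * u) t) MeasureTheory.volume a b :=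
    fun s t a b h => (hmu s t h).intervalIntegrable
  let H : ℝ → ℝ → ℝ := fun s t => ∫ u in (1:ℝ)..2, G (s * u) t
  have Hle : ∀ s t, 0 ≤ s → H s t ≤ G (2 * s) t := by
    intro s t h
    have := intervalIntegral.integral_mono_on (a := 1) (b := 2) (by norm_num) (hintu s t 1 2 h)
      (intervalIntegrable_const (c := G (2*s) t)) (fun u hu => hm t (by
        have := hu.2; show s * u ≤ 2 * s; nlinarith))
    simp at this
    norm_num at this
    exact this
  have leH : ∀ s t, 0 ≤ s → G s t ≤ H s t := by
    intro s t h
    have := intervalIntegral.integral_mono_on (a := 1) (b := 2) (by norm_num) 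
      (intervalIntegrable_const (c := G s t)) (hintu s t 1 2 h) (fun u hu => hm t (by
        have := hu.1; show s ≤ s * u; nlinarith))
    simp at this
    norm_num at this
    exact this
  have H0 : ∀ s t, 0 ≤ s → 0 ≤ H s t := fun s t h => (h0 s t).trans (leH s t h)
  have G0 : ∀ t, 0 ≤ t → G 0 t = 0 := by
    intro t h
    refine le_antisymm (le_of_forall_pos_le_add fun ε he => ?_) (h0 _ _)
    obtain ⟨δ, hd, h'⟩ := hs ε he
    have := hm t hd.le
    have := h' t h
    simp only at *
    linarith
  have Hz : ∀ t, 0 ≤ t → H 0 t = 0 := fun t h =>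
    le_antisymm (by have := Hle 0 t le_rfl; rwa [mul_zero, G0 t h] at this) (H0 _ _ le_rfl)
  have Hm : ∀ s s' t, 0 ≤ s → s ≤ s' → H s t ≤ H s' t := by
    intro s s' t h h'
    exact intervalIntegral.integral_mono_on (by norm_num) (hintu s t 1 2 h)
      (hintu s' t 1 2 (h.trans h')) (fun u hu => hm t (by
        have := hu.1; show s * u ≤ s' * u; nlinarith))
  have Ha : ∀ s t t', 0 ≤ s → t ≤ t' → H s t' ≤ H s t := by
    intro s t t' h h'
    exact intervalIntegral.integral_mono_on (by norm_num) (hintu s t' 1 2 h)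
      (hintu s t 1 2 h) (fun u hu => ha _ h')
  have Hc : ∀ t, 0 ≤ t → ContinuousOn (fun s => H s t) (Set.Ici 0) := by
    intro t h s hs'
    rcases eq_or_lt_of_le (show (0:ℝ) ≤ s from hs') with rfl | hpos
    · rw [Metric.continuousWithinAt_iff]
      intro ε he
      obtain ⟨δ, hd, h'⟩ := hs (ε/2) (by positivity)
      refine ⟨δ/2, by positivity, fun {x} hx hxd => ?_⟩
      have hx0 : (0:ℝ) ≤ x := hx
      rw [Real.dist_eq, sub_zero, abs_of_nonneg hx0] at hxd
      rw [Hz t h, Real.dist_eq, sub_zero, abs_of_nonneg (H0 x t hx0)]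
      have h1 := Hle x t hx0
      have h2 := hm t (show 2 * x ≤ δ by linarith)
      have h3 := h' t h
      simp only at *
      linarith
    · apply ContinuousAt.continuousWithinAt
      have hp : Continuous (fun b => ∫ u in (0:ℝ)..b, G u t) :=
        intervalIntegral.continuous_primitive (fun a b => hint t a b) 0
      have hc : ContinuousAt (fun s : ℝ => s⁻¹ * ((∫ u in (0:ℝ)..(s * 2), G u t)
          - ∫ u in (0:ℝ)..(s*1), G u t)) s := by
        refine (continuousAt_inv₀ hpos.ne').mul (ContinuousAt.sub ?_ ?_)
        · exact (hp.comp (continuous_id.mul continuous_const)).continuousAt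
        · exact (hp.comp (continuous_id.mul continuous_const)).continuousAt
      refine hc.congr ?_
      filter_upwards [lt_mem_nhds hpos] with y hy
      have := intervalIntegral.integral_comp_mul_left (a := 1) (b := 2) (fun u => G u t) hy.ne'
      show _ = ∫ u in (1:ℝ)..2, G (y * u) t
      rw [this, smul_eq_mul, intervalIntegral.integral_interval_sub_left (hint t _ _) (hint t _ _)]
  refine ⟨fun s t => H s t + s * Real.exp (-t), ⟨fun t h => ⟨?_, ?_, ?_⟩, fun s h => ⟨?_, ?_⟩⟩, ?_⟩
  · exact (Hc t h).add (continuous_id.mul continuous_const).continuousOn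
  · intro a ha' b hb hab
    exact add_lt_add_of_le_of_lt (Hm a b t ha' hab.le)
      (mul_lt_mul_of_pos_right hab (Real.exp_pos _))
  · simp [Hz t h]
  · intro a ha' b hb hab
    exact add_lt_add_of_le_of_lt (Ha s a b h.le hab.le)
      (mul_lt_mul_of_pos_left (Real.exp_lt_exp.2 (by linarith)) h)
  · have h1 : Filter.Tendsto (fun t => H s t) Filter.atTop (nhds 0) := by
      rw [Metric.tendsto_atTop]
      intro ε he
      obtain ⟨τ, h'⟩ := ht (2 * s) (ε/2) (by positivity)
      refine ⟨τ, fun t htt => ?_⟩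
      rw [Real.dist_eq, sub_zero, abs_of_nonneg (H0 s t h.le)]
      have h1 := Hle s t h.le
      have h2 := ha (2*s) htt
      linarith
    have h2 := (Real.tendsto_exp_neg_atTop_nhds_zero).const_mul s
    simpa using h1.add h2
  · intro s t h h'
    have := leH s t h
    have : 0 ≤ s * Real.exp (-t) := by positivity
    simp only
    linarith

theorem kl_of_rel (R : ℝ → ℝ → ℝ → Prop) (hR : ∀ a b r, R a b r → 0 ≤ a ∧ 0 ≤ b ∧ 0 ≤ r)
    (h1 : ∀ ε, 0 < ε → ∃ δ, 0 < δ ∧ ∀ a b r, R a b r → a ≤ δ → r ≤ ε)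
    (h2 : ∀ s, ∃ K, ∀ a b r, R a b r → a ≤ s → r ≤ K)
    (h3 : ∀ s ε, 0 < ε → ∃ τ, ∀ a b r, R a b r → a ≤ s → τ ≤ b → r ≤ ε) :
    ∃ β : ℝ → ℝ → ℝ, ClassKL β ∧ ∀ a b r, R a b r → r ≤ β a b := by
  let S : ℝ → ℝ → Set ℝ := fun s t => {r | ∃ a b, R a b r ∧ a ≤ s ∧ t ≤ b}
  have hb : ∀ s t, BddAbove (S s t) := by
    intro s t
    obtain ⟨K, hK⟩ := h2 s
    exact ⟨K, fun r ⟨a, b, h, h', _⟩ => hK a b r h h'⟩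
  have hn : ∀ s t, 0 ≤ sSup (S s t) := fun s t =>
    Real.sSup_nonneg (fun r ⟨a, b, h, _⟩ => (hR a b r h).2.2)
  obtain ⟨β, hβ, hle⟩ := kl_of_mono (fun s t => sSup (S s t)) hn
    (fun t s s' hss => Real.sSup_le (fun r ⟨a, b, h, h', h''⟩ =>
      le_csSup (hb s' t) ⟨a, b, h, h'.trans hss, h''⟩) (hn _ _))
    (fun s t t' htt => Real.sSup_le (fun r ⟨a, b, h, h', h''⟩ =>
      le_csSup (hb s t) ⟨a, b, h, h', htt.trans h''⟩) (hn _ _))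
    (fun ε he => by
      obtain ⟨δ, hd, h⟩ := h1 ε he
      exact ⟨δ, hd, fun t _ => Real.sSup_le (fun r ⟨a, b, h', h'', _⟩ => h a b r h' h'') he.le⟩)
    (fun s ε he => by
      obtain ⟨τ, h⟩ := h3 s ε he
      exact ⟨τ, Real.sSup_le (fun r ⟨a, b, h', h'', h'''⟩ => h a b r h' h'' h''') he.le⟩)
  refine ⟨β, hβ, fun a b r h => ?_⟩
  obtain ⟨ha, hb', _⟩ := hR a b r h
  exact (le_csSup (hb a b) ⟨a, b, h, le_rfl, le_rfl⟩).trans (hle a b ha hb')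

theorem statement1 {n p : ℕ}
    (F : EuclideanSpace ℝ (Fin n) → EuclideanSpace ℝ (Fin p) → ℝ → EuclideanSpace ℝ (Fin n)) (D : ℝ) (hD : 0 < D)
    (h : ∃ δ : ℝ → ℝ, (∀ ε, 0 < ε → 0 < δ ε) ∧
      ∀ M, 0 ≤ M → ∃ Tmax, 0 < Tmax ∧
        ((∀ ε, 0 < ε →
          ∀ (x : ℕ → EuclideanSpace ℝ (Fin n)) (d : ℕ → EuclideanSpace ℝ (Fin p)) (T : ℕ → ℝ),
            (∀ k, x (k + 1) = F (x k) (d k) (T k)) →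
            ‖x 0‖ ≤ min (δ ε) M → (∀ i, 0 < T i ∧ T i < Tmax) → (∀ i, ‖d i‖ ≤ D) →
            ∀ k, ‖x k‖ ≤ ε) ∧
        (∀ L, 0 ≤ L → ∃ C, 0 ≤ C ∧
          ∀ (x : ℕ → EuclideanSpace ℝ (Fin n)) (d : ℕ → EuclideanSpace ℝ (Fin p)) (T : ℕ → ℝ),
            (∀ k, x (k + 1) = F (x k) (d k) (T k)) →
            ‖x 0‖ ≤ M → (∀ i, 0 < T i ∧ T i < Tmax) → (∀ i, ‖d i‖ ≤ D) →
            ∀ k, (∑ i ∈ Finset.range k, T i) ≤ L → ‖x k‖ ≤ C) ∧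
        (∀ ε, 0 < ε → ∃ τ, 0 ≤ τ ∧
          ∀ (x : ℕ → EuclideanSpace ℝ (Fin n)) (d : ℕ → EuclideanSpace ℝ (Fin p)) (T : ℕ → ℝ),
            (∀ k, x (k + 1) = F (x k) (d k) (T k)) →
            ‖x 0‖ ≤ M → (∀ i, 0 < T i ∧ T i < Tmax) → (∀ i, ‖d i‖ ≤ D) →
            ∀ k, τ ≤ ∑ i ∈ Finset.range k, T i → ‖x k‖ ≤ ε))) :
    RSSVSR F D := by
  obtain ⟨δ, hδ, h⟩ := h
  have h' : ∀ j : ℕ, _ := fun j => h j (Nat.cast_nonneg j)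
  choose Tm hT hA hB hC using h'
  choose C hC0 hC1 using hB
  choose τ hτ0 hτ1 using hC
  have hce : ∀ {a s : ℝ}, a ≤ s → ⌈a⌉₊ ∈ Finset.range (⌈s⌉₊ + 1) := fun h =>
    Finset.mem_range.2 (Nat.lt_succ_of_le (Nat.ceil_mono h))
  obtain ⟨β, hβ, hle⟩ := kl_of_rel (fun a b r => ∃ (x : ℕ → EuclideanSpace ℝ (Fin n))
      (d : ℕ → EuclideanSpace ℝ (Fin p)) (T : ℕ → ℝ) (k : ℕ),
      (∀ k, x (k + 1) = F (x k) (d k) (T k)) ∧ (∀ i, 0 < T i ∧ T i < Tm ⌈‖x 0‖⌉₊) ∧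
      (∀ i, ‖d i‖ ≤ D) ∧ a = ‖x 0‖ ∧ b = ∑ i ∈ Finset.range k, T i ∧ r = ‖x k‖)
    (by
      rintro a b r ⟨x, d, T, k, hx, hTT, hd, rfl, rfl, rfl⟩
      exact ⟨norm_nonneg _, Finset.sum_nonneg fun i _ => (hTT i).1.le, norm_nonneg _⟩)
    (by
      intro ε he
      refine ⟨δ ε, hδ ε he, ?_⟩
      rintro a b r ⟨x, d, T, k, hx, hTT, hd, rfl, rfl, rfl⟩ ha
      exact hA _ ε he x d T hx (le_min ha (Nat.le_ceil _)) hTT hd k)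
    (by
      intro s
      refine ⟨∑ j ∈ Finset.range (⌈s⌉₊ + 1), (C j (τ j 1 one_pos) (hτ0 _ _ _) + 1), ?_⟩
      rintro a b r ⟨x, d, T, k, hx, hTT, hd, rfl, rfl, rfl⟩ ha
      have hs := Finset.single_le_sum
        (f := fun j => C j (τ j 1 one_pos) (hτ0 _ _ _) + 1)
        (fun j _ => add_nonneg (hC0 j _ _) zero_le_one) (hce ha)
      refine le_trans ?_ hs
      have h0 := hC0 ⌈‖x 0‖⌉₊ (τ ⌈‖x 0‖⌉₊ 1 one_pos) (hτ0 _ _ _)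
      rcases le_total (∑ i ∈ Finset.range k, T i) (τ ⌈‖x 0‖⌉₊ 1 one_pos) with hk | hk
      · have := hC1 _ _ (hτ0 _ _ _) x d T hx (Nat.le_ceil _) hTT hd k hk
        linarith
      · have := hτ1 _ 1 one_pos x d T hx (Nat.le_ceil _) hTT hd k hk
        linarith)
    (by
      intro s ε he
      refine ⟨∑ j ∈ Finset.range (⌈s⌉₊ + 1), τ j ε he, ?_⟩
      rintro a b r ⟨x, d, T, k, hx, hTT, hd, rfl, rfl, rfl⟩ ha hk
      have hs := Finset.single_le_sum (f := fun j => τ j ε he)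
        (fun j _ => hτ0 j _ _) (hce ha)
      exact hτ1 _ ε he x d T hx (Nat.le_ceil _) hTT hd k (hs.trans hk))
  refine ⟨β, hβ, fun M hM => ?_⟩
  obtain ⟨j, _, hj⟩ := Finset.exists_min_image (Finset.range (⌈M⌉₊ + 1)) Tm ⟨0, by simp⟩
  refine ⟨Tm j, hT j, fun x d T hx hxM hTT hd k => ?_⟩
  exact hle _ _ _ ⟨x, d, T, k, hx, fun i => ⟨(hTT i).1, (hTT i).2.trans_le (hj _ (hce hxM))⟩,
    hd, rfl, rfl, rfl⟩
end

section
/- Suppose the system x_{k+1} = F̄(x_k, d_k, T_k) is RSS-VSR. Then there exist functions α₁, α₂, α₃ of class K∞ such that for every M ≥ 0 there exist T* = T*(M) > 0 and a function V_M : ℝⁿ → ℝ≥0 ∪ {∞} such that: α₁(|x|) ≤ V_M(x) for all x ∈ ℝⁿ; V_M(x) ≤ α₂(|x|) for all |x| ≤ M; and V_M(F̄(x,d,T)) − V_M(x) ≤ −T·α₃(|x|) for all |x| ≤ M, all |d| ≤ D and all T ∈ (0, T*). -/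
open scoped BigOperators

lemma aux_q (β : ℝ → ℝ → ℝ) (hβ : ClassKL β) :
    ∃ q : ℝ → ℝ, Monotone q ∧ (∀ s, 1 ≤ q s) ∧
      ∀ s t, 1 ≤ s → 0 ≤ t → 1 / s ≤ β s t → Real.exp t ≤ q s := by
  let S : ℝ → Set ℝ := fun m => insert 1 {y | ∃ t, 0 ≤ t ∧ 1 / m ≤ β m t ∧ y = Real.exp t}
  have hb : ∀ m, 1 ≤ m → BddAbove (S m) := by
    intro m hm
    have hm0 : 0 < m := by linarith
    have h1 : ∀ᶠ t in Filter.atTop, β m t < 1 / m :=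
      (hβ.2 m hm0).2.eventually_lt_const (by positivity)
    obtain ⟨t0, ht0⟩ := Filter.eventually_atTop.1 h1
    refine ⟨max 1 (Real.exp t0), ?_⟩
    rintro y (rfl | ⟨t, ht, h2, rfl⟩)
    · exact le_max_left _ _
    · apply le_max_of_le_right
      apply Real.exp_le_exp.2
      by_contra hc
      have := ht0 t (by linarith)
      linarith
  have hsub : ∀ m m', 1 ≤ m → m ≤ m' → S m ⊆ S m' := by
    intro m m' hm hmm
    rintro y (rfl | ⟨t, ht, h2, rfl⟩)
    · exact Set.mem_insert _ _
    · right
      refine ⟨t, ht, ?_, rfl⟩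
      have h3 : β m t ≤ β m' t :=
        (hβ.1 t ht).2.1.monotoneOn (Set.mem_Ici.2 (by linarith)) (Set.mem_Ici.2 (by linarith)) hmm
      have h4 : 1 / m' ≤ 1 / m := one_div_le_one_div_of_le (by linarith) hmm
      linarith
  refine ⟨fun s => sSup (S (max s 1)), ?_, ?_, ?_⟩
  · intro a b hab
    exact csSup_le_csSup (hb _ (le_max_right _ _)) ⟨1, Set.mem_insert _ _⟩
      (hsub _ _ (le_max_right _ _) (max_le_max_right 1 hab))
  · intro s
    exact le_csSup (hb _ (le_max_right _ _)) (Set.mem_insert _ _)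
  · intro s t hs ht h
    have : max s 1 = s := max_eq_left hs
    show _ ≤ sSup (S (max s 1))
    rw [this]
    exact le_csSup (hb _ hs) (Or.inr ⟨t, ht, h, rfl⟩)

lemma aux_mu (q : ℝ → ℝ) (hq : Monotone q) (hq1 : ∀ s, 1 ≤ q s) :
    ∃ μ : ℝ → ℝ, ClassKInf μ ∧ ∀ r, 0 < r → r ≤ 1 → μ r ≤ 1 / q (1 / r) := by
  let A : ℝ → ℝ := fun r => if r ≤ 0 then 0 else 1 / q (1 / r)
  have hqp : ∀ s, 0 < q s := fun s => by linarith [hq1 s]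
  have hApos : ∀ r, 0 < r → 0 < A r := by
    intro r hr
    have := hqp (1 / r)
    simp only [A, not_le.2 hr, if_false]
    positivity
  have hA : Monotone A := by
    intro a b hab
    by_cases ha : a ≤ 0
    · by_cases hb : b ≤ 0
      · simp [A, ha, hb]
      · have := hApos b (not_le.1 hb)
        have h2 : A a = 0 := by simp [A, ha]
        linarith
    · have ha' := not_le.1 ha
      have hb : ¬ b ≤ 0 := by linarith
      simp only [A, ha, hb, if_false]
      exact one_div_le_one_div_of_le (hqp _) (hq (one_div_le_one_div_of_le ha' hab))
  have hi : ∀ a b, IntervalIntegrable A MeasureTheory.volume a b := fun a b => hA.intervalIntegrable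
  have hlow : ∀ a b, a ≤ b → (b - a) * A a ≤ ∫ x in a..b, A x := by
    intro a b hab
    have := intervalIntegral.integral_mono_on (μ := MeasureTheory.volume) hab
      (intervalIntegrable_const (c := A a)) (hi a b) (fun x hx => hA hx.1)
    simpa using this
  have hup : ∀ a b, a ≤ b → ∫ x in a..b, A x ≤ (b - a) * A b := by
    intro a b hab
    have := intervalIntegral.integral_mono_on (μ := MeasureTheory.volume) hab
      (hi a b) (intervalIntegrable_const (c := A b)) (fun x hx => hA hx.2)
    simpa using this
  have hadd : ∀ a b, (∫ x in (0:ℝ)..b, A x) = (∫ x in (0:ℝ)..a, A x) + ∫ x in a..b, A x :=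
    fun a b => (intervalIntegral.integral_add_adjacent_intervals (hi 0 a) (hi a b)).symm
  have hA0 : A 0 = 0 := by simp [A]
  have hnn : ∀ b, 0 ≤ b → 0 ≤ ∫ x in (0:ℝ)..b, A x := by
    intro b hb
    have := hlow 0 b hb
    rw [hA0] at this
    simpa using this
  refine ⟨fun r => ∫ x in (0:ℝ)..r, A x, ⟨⟨?_, ?_, by simp⟩, ?_⟩, ?_⟩
  · exact (intervalIntegral.continuous_primitive hi 0).continuousOn
  · intro a ha b hb hab
    have ha : 0 ≤ a := ha
    show (∫ x in (0:ℝ)..a, A x) < ∫ x in (0:ℝ)..b, A x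
    rw [hadd ((a + b) / 2) b, hadd a ((a + b) / 2)]
    have h1 := hlow a ((a + b) / 2) (by linarith)
    have h2 := hlow ((a + b) / 2) b (by linarith)
    have h3 : 0 ≤ A a := hA0 ▸ hA ha
    have h4 := hApos ((a + b) / 2) (by linarith)
    have h5 : 0 ≤ ((a + b) / 2 - a) * A a := mul_nonneg (by linarith) h3
    have h6 : 0 < (b - (a + b) / 2) * A ((a + b) / 2) := mul_pos (by linarith) h4
    linarith
  · have h1 := hApos 1 one_pos
    have ht : Filter.Tendsto (fun r : ℝ => (r - 1) * A 1) Filter.atTop Filter.atTop :=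
      (Filter.tendsto_atTop_add_const_right _ (-1) Filter.tendsto_id).atTop_mul_const h1
    refine Filter.tendsto_atTop_mono' _ ?_ ht
    filter_upwards [Filter.eventually_ge_atTop 1] with r hr
    rw [hadd 1 r]
    have := hlow 1 r hr
    have := hnn 1 zero_le_one
    linarith
  · intro r hr hr1
    have h1 := hup 0 r hr.le
    have h2 : A r = 1 / q (1 / r) := by simp [A, not_le.2 hr]
    have h3 := hApos r hr
    show (∫ x in (0:ℝ)..r, A x) ≤ _
    rw [← h2]
    nlinarith

lemma aux_Q (q : ℝ → ℝ) (hq : Monotone q) :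
    ∃ Q : ℝ → ℝ, Continuous Q ∧ Monotone Q ∧ ∀ s, q s ≤ Q s := by
  have hi : ∀ a b, IntervalIntegrable q MeasureTheory.volume a b := fun a b => hq.intervalIntegrable
  have hsh : ∀ s, IntervalIntegrable (fun x => q (x + s)) MeasureTheory.volume 0 1 := fun s =>
    Monotone.intervalIntegrable (fun a b hab => hq (by linarith))
  refine ⟨fun s => ∫ x in (0:ℝ)..1, q (x + s), ?_, ?_, ?_⟩
  · have : (fun s => ∫ x in (0:ℝ)..1, q (x + s))
        = fun s => (∫ x in (0:ℝ)..(1 + s), q x) - ∫ x in (0:ℝ)..s, q x := by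
      funext s
      rw [intervalIntegral.integral_comp_add_right (fun x => q x) s,
        intervalIntegral.integral_interval_sub_left (hi _ _) (hi _ _)]
      simp
    rw [this]
    have hc := intervalIntegral.continuous_primitive hi 0
    exact (hc.comp (continuous_const.add continuous_id)).sub hc
  · intro a b hab
    exact intervalIntegral.integral_mono_on zero_le_one (hsh a) (hsh b)
      (fun x _ => hq (by linarith))
  · intro s
    have := intervalIntegral.integral_mono_on (μ := MeasureTheory.volume) zero_le_one
      (intervalIntegrable_const (c := q s)) (hsh s) (fun x hx => hq (by linarith [hx.1]))
    simpa using this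

lemma ClassK.nonneg' {f : ℝ → ℝ} (hf : ClassK f) {s : ℝ} (hs : 0 ≤ s) : 0 ≤ f s := by
  have := hf.2.1.monotoneOn (Set.mem_Ici.2 le_rfl) (Set.mem_Ici.2 hs) hs
  rwa [hf.2.2] at this

lemma aux_sontag (β : ℝ → ℝ → ℝ) (hβ : ClassKL β) :
    ∃ σ α : ℝ → ℝ, ClassKInf σ ∧ ClassKInf α ∧
      ∀ s t, 0 ≤ s → 0 ≤ t → σ (β s t) * Real.exp t ≤ α s := by
  obtain ⟨q, hq, hq1, hqb⟩ := aux_q β hβ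
  obtain ⟨μ, hμ, hμb⟩ := aux_mu q hq hq1
  obtain ⟨Q, hQc, hQ, hQb⟩ := aux_Q q hq
  let Q' : ℝ → ℝ := fun s => Q (max s 1)
  have hQ'0 : ∀ s, 0 ≤ Q' s := fun s => by
    have := hQb (max s 1); have := hq1 (max s 1); show 0 ≤ Q _; linarith
  have hQ'm : Monotone Q' := fun a b hab => hQ (max_le_max_right 1 hab)
  have hQ'c : Continuous Q' := hQc.comp (continuous_id.max continuous_const)
  have hb : ClassK (fun s => β s 0) := hβ.1 0 le_rfl
  let g : ℝ → ℝ := fun s => μ (β s 0)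
  have hg : ClassK g := by
    refine ⟨hμ.1.1.comp hb.1 (fun s hs => hb.nonneg' hs), ?_, ?_⟩
    · intro a ha b hb' hab
      exact hμ.1.2.1 (hb.nonneg' ha) (hb.nonneg' hb') (hb.2.1 ha hb' hab)
    · show μ (β 0 0) = 0
      rw [(hβ.1 0 le_rfl).2.2, hμ.1.2.2]
  refine ⟨fun r => μ r * μ r, fun s => s + g s * (1 + g s * Q' s), ⟨⟨?_, ?_, ?_⟩, ?_⟩,
    ⟨⟨?_, ?_, ?_⟩, ?_⟩, ?_⟩
  · exact hμ.1.1.mul hμ.1.1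
  · intro a ha b hb' hab
    exact mul_self_lt_mul_self (hμ.1.nonneg' ha) (hμ.1.2.1 ha hb' hab)
  · simp [hμ.1.2.2]
  · exact hμ.2.atTop_mul_atTop₀ hμ.2
  · exact continuousOn_id.add (hg.1.mul (continuousOn_const.add (hg.1.mul hQ'c.continuousOn)))
  · intro a ha b hb' hab
    have h1 := (hg.2.1 ha hb' hab).le
    have h2 := hg.nonneg' ha
    have h2' := hg.nonneg' hb'
    have h3 := hQ'm hab.le
    have h4 := hQ'0 a
    have h5 : g a * Q' a ≤ g b * Q' b := mul_le_mul h1 h3 h4 h2'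
    have h6 : g a * (1 + g a * Q' a) ≤ g b * (1 + g b * Q' b) :=
      mul_le_mul h1 (by linarith) (by positivity) h2'
    show a + g a * (1 + g a * Q' a) < b + g b * (1 + g b * Q' b)
    linarith
  · simp [hg.2.2]
  · refine Filter.tendsto_atTop_mono' _ ?_ Filter.tendsto_id
    filter_upwards [Filter.eventually_ge_atTop 0] with s hs
    have := hg.nonneg' hs
    have := hQ'0 s
    have : 0 ≤ g s * (1 + g s * Q' s) := by positivity
    show s ≤ _
    linarith
  · intro s t hs ht
    have hgs := hg.nonneg' hs
    have hQs := hQ'0 s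
    show μ (β s t) * μ (β s t) * Real.exp t ≤ s + g s * (1 + g s * Q' s)
    have hrhs : 0 ≤ s + g s * (1 + g s * Q' s) := by positivity
    rcases hs.eq_or_lt with rfl | hs0
    · rw [(hβ.1 t ht).2.2, hμ.1.2.2]
      simpa using hrhs
    have hr0 : 0 ≤ β s t := ClassK.nonneg' (f := fun s => β s t) (hβ.1 t ht) hs
    have hrb : β s t ≤ β s 0 := (hβ.2 s hs0).1.antitoneOn (Set.mem_Ici.2 le_rfl) (Set.mem_Ici.2 ht) ht
    have hμr : μ (β s t) ≤ g s := hμ.1.2.1.monotoneOn hr0 (hb.nonneg' hs) hrb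
    have hμ0 := hμ.1.nonneg' hr0
    have he := Real.exp_pos t
    have hmpos : 0 < max s 1 := lt_max_of_lt_right one_pos
    by_cases hc : 1 / max s 1 ≤ β s t
    · have h1 : β s t ≤ β (max s 1) t :=
        (hβ.1 t ht).2.1.monotoneOn (Set.mem_Ici.2 hs) (Set.mem_Ici.2 hmpos.le) (le_max_left _ _)
      have h2 := hqb (max s 1) t (le_max_right _ _) ht (hc.trans h1)
      have h3 : Real.exp t ≤ Q' s := h2.trans (hQb _)
      have h4 : μ (β s t) * μ (β s t) * Real.exp t ≤ g s * g s * Q' s :=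
        mul_le_mul (mul_le_mul hμr hμr hμ0 hgs) h3 he.le (by positivity)
      nlinarith
    · rcases hr0.eq_or_lt with h0 | hr
      · rw [← h0, hμ.1.2.2]
        simpa using hrhs
      have hc' := (not_le.1 hc).le
      have hm : max s 1 ≤ 1 / β s t := by
        rw [le_div_iff₀ hr]; rw [le_div_iff₀ hmpos] at hc'; linarith
      have hm1 : 1 ≤ 1 / β s t := (le_max_right _ _).trans hm
      have hr1 : β s t ≤ 1 := by rw [le_div_iff₀ hr] at hm1; linarith
      have h1 : β s t ≤ β (1 / β s t) t :=
        (hβ.1 t ht).2.1.monotoneOn (Set.mem_Ici.2 hs) (Set.mem_Ici.2 (by positivity))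
          ((le_max_left _ _).trans hm)
      have h2 := hqb (1 / β s t) t hm1 ht (by simpa using h1)
      have h3 := hμb _ hr hr1
      have h4 : μ (β s t) * Real.exp t ≤ 1 := by
        have hqp : 0 < q (1 / β s t) := by linarith [hq1 (1 / β s t)]
        rw [le_div_iff₀ hqp] at h3
        exact (mul_le_mul_of_nonneg_left h2 hμ0).trans h3
      have h5 : μ (β s t) * (μ (β s t) * Real.exp t) ≤ g s * 1 :=
        mul_le_mul hμr h4 (by positivity) hgs
      have h6 : 0 ≤ g s * (g s * Q' s) := by positivity
      nlinarith

theorem statement2 {n p : ℕ}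
    (F : EuclideanSpace ℝ (Fin n) → EuclideanSpace ℝ (Fin p) → ℝ → EuclideanSpace ℝ (Fin n)) (D : ℝ) (hD : 0 < D)
    (h : RSSVSR F D) :
    ∃ α₁ α₂ α₃ : ℝ → ℝ, ClassKInf α₁ ∧ ClassKInf α₂ ∧ ClassKInf α₃ ∧
      ∀ M, 0 ≤ M → ∃ Tstar, 0 < Tstar ∧
        ∃ V : EuclideanSpace ℝ (Fin n) → ENNReal,
          (∀ x : EuclideanSpace ℝ (Fin n), ENNReal.ofReal (α₁ ‖x‖) ≤ V x) ∧
          (∀ x : EuclideanSpace ℝ (Fin n), ‖x‖ ≤ M → V x ≤ ENNReal.ofReal (α₂ ‖x‖)) ∧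
          (∀ (x : EuclideanSpace ℝ (Fin n)) (d : EuclideanSpace ℝ (Fin p)) (T : ℝ), ‖x‖ ≤ M → ‖d‖ ≤ D → 0 < T → T < Tstar →
            V (F x d T) + ENNReal.ofReal (T * α₃ ‖x‖) ≤ V x) := by
  obtain ⟨β, hβ, hsol⟩ := h
  obtain ⟨σ, α, hσ, hα, hb⟩ := aux_sontag β hβ
  refine ⟨σ, α, fun r => σ r / 2, hσ, hα, ⟨⟨hσ.1.1.div_const 2, ?_, ?_⟩, ?_⟩, ?_⟩
  · intro a ha b hb' hab
    have := hσ.1.2.1 ha hb' hab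
    show σ a / 2 < σ b / 2
    linarith
  · simp [hσ.1.2.2]
  · exact hσ.2.atTop_div_const two_pos
  intro M hM
  obtain ⟨Tm, hTm, hs⟩ := hsol M hM
  refine ⟨min Tm 1, lt_min hTm one_pos, ?_⟩
  let ok : (ℕ → EuclideanSpace ℝ (Fin n)) → (ℕ → EuclideanSpace ℝ (Fin p)) → (ℕ → ℝ) → Prop :=
    fun x d T => (∀ k, x (k + 1) = F (x k) (d k) (T k)) ∧ (∀ i, 0 < T i ∧ T i < Tm) ∧
      (∀ i, ‖d i‖ ≤ D)
  let W : EuclideanSpace ℝ (Fin n) → Set ENNReal := fun x0 =>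
    {y | ∃ x d T k, ok x d T ∧ x 0 = x0 ∧
      y = ENNReal.ofReal (σ ‖x k‖ * Real.exp (∑ i ∈ Finset.range k, T i))}
  let V : EuclideanSpace ℝ (Fin n) → ENNReal := fun x0 => sSup (W x0)
  have hlow : ∀ x, ENNReal.ofReal (σ ‖x‖) ≤ V x := by
    intro x
    refine le_sSup ⟨fun k => Nat.rec x (fun _ y => F y 0 (Tm / 2)) k, fun _ => 0, fun _ => Tm / 2,
      0, ⟨fun k => rfl, fun i => ⟨by positivity, by linarith⟩, fun i => by simpa using hD.le⟩,
      rfl, ?_⟩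
    simp
  have hup : ∀ x, ‖x‖ ≤ M → V x ≤ ENNReal.ofReal (α ‖x‖) := by
    intro x hx
    refine sSup_le ?_
    rintro y ⟨xs, d, T, k, ⟨h1, h2, h3⟩, rfl, rfl⟩
    apply ENNReal.ofReal_le_ofReal
    have h4 := hs xs d T h1 hx h2 h3 k
    have h5 : 0 ≤ ∑ i ∈ Finset.range k, T i := Finset.sum_nonneg (fun i _ => (h2 i).1.le)
    refine le_trans ?_ (hb ‖xs 0‖ _ (norm_nonneg _) h5)
    refine mul_le_mul_of_nonneg_right ?_ (Real.exp_pos _).le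
    exact hσ.1.2.1.monotoneOn (norm_nonneg _) (le_trans (norm_nonneg _) h4) h4
  refine ⟨V, hlow, hup, ?_⟩
  intro x d T hx hd hT hT'
  have hTm' : T < Tm := lt_of_lt_of_le hT' (min_le_left _ _)
  have hT1 : T < 1 := lt_of_lt_of_le hT' (min_le_right _ _)
  have hfin : V x ≠ ⊤ := ne_top_of_le_ne_top ENNReal.ofReal_ne_top (hup x hx)
  have hstep : V (F x d T) ≤ ENNReal.ofReal ((V x).toReal * Real.exp (-T)) := by
    refine sSup_le ?_
    rintro y ⟨xs, ds, Ts, k, ⟨h1, h2, h3⟩, h0, rfl⟩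
    apply ENNReal.ofReal_le_ofReal
    have hmem : ENNReal.ofReal (σ ‖xs k‖ * Real.exp (T + ∑ i ∈ Finset.range k, Ts i)) ≤ V x := by
      refine le_sSup ⟨fun j => Nat.casesOn j x xs, fun j => Nat.casesOn j d ds,
        fun j => Nat.casesOn j T Ts, k + 1, ⟨?_, ?_, ?_⟩, rfl, ?_⟩
      · rintro (_ | k)
        · exact h0
        · exact h1 k
      · rintro (_ | i)
        · exact ⟨hT, hTm'⟩
        · exact h2 i
      · rintro (_ | i)
        · exact hd
        · exact h3 i
      · rw [Finset.sum_range_succ', add_comm T]; rfl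
    have h4 := (ENNReal.ofReal_le_iff_le_toReal hfin).1 hmem
    rw [Real.exp_add] at h4
    have h6 : Real.exp T * Real.exp (-T) = 1 := by rw [← Real.exp_add]; simp
    have h7 := mul_le_mul_of_nonneg_right h4 (Real.exp_pos (-T)).le
    calc _ = σ ‖xs k‖ * (Real.exp T * Real.exp (∑ i ∈ Finset.range k, Ts i)) * Real.exp (-T) := by
            linear_combination (-(σ ‖xs k‖ * Real.exp (∑ i ∈ Finset.range k, Ts i))) * h6
      _ ≤ _ := h7
  have hσ0 : 0 ≤ σ ‖x‖ := hσ.1.nonneg' (norm_nonneg _)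
  have hv := (ENNReal.ofReal_le_iff_le_toReal hfin).1 (hlow x)
  have hv0 : 0 ≤ (V x).toReal := ENNReal.toReal_nonneg
  refine (add_le_add_left hstep _).trans ?_
  rw [← ENNReal.ofReal_add (by positivity) (by positivity)]
  refine ENNReal.ofReal_le_of_le_toReal ?_
  have hE : Real.exp (-T) ≤ 1 - T / 2 := by
    have h6 : Real.exp T * Real.exp (-T) = 1 := by rw [← Real.exp_add]; simp
    have h7 := Real.add_one_le_exp T
    have h8 := Real.exp_pos (-T)
    have h9 : (1 + T) * Real.exp (-T) ≤ 1 := by nlinarith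
    by_contra hc
    nlinarith [not_le.1 hc]
  nlinarith [mul_le_mul_of_nonneg_left hE hv0, mul_le_mul_of_nonneg_left hv hT.le]
end

section
/- Suppose there exist functions α₁, α₂, α₃ of class K∞ such that for every M ≥ 0 there exist T* = T*(M) > 0 and a function V_M : ℝⁿ → ℝ≥0 ∪ {∞} satisfying: α₁(|x|) ≤ V_M(x) for all x ∈ ℝⁿ; V_M(x) ≤ α₂(|x|) for all |x| ≤ M; and V_M(F̄(x,d,T)) − V_M(x) ≤ −T·α₃(|x|) for all |x| ≤ M, all |d| ≤ D and all T ∈ (0, T*). Then the system x_{k+1} = F̄(x_k, d_k, T_k) is RSS-VSR. -/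
open scoped BigOperators

theorem ClassKInf.nonneg {f : ℝ → ℝ} (hf : ClassKInf f) {x : ℝ} (hx : 0 ≤ x) : 0 ≤ f x := by
  have := hf.1.2.1.monotoneOn (Set.mem_Ici.2 le_rfl) (Set.mem_Ici.2 hx) hx
  rwa [hf.1.2.2] at this

theorem ClassKInf.pos {f : ℝ → ℝ} (hf : ClassKInf f) {x : ℝ} (hx : 0 < x) : 0 < f x := by
  have := hf.1.2.1 (Set.mem_Ici.2 le_rfl) (Set.mem_Ici.2 hx.le) hx
  rwa [hf.1.2.2] at this

theorem ClassKInf.mono {f : ℝ → ℝ} (hf : ClassKInf f) {x y : ℝ} (hx : 0 ≤ x) (h : x ≤ y) :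
    f x ≤ f y :=
  hf.1.2.1.monotoneOn (Set.mem_Ici.2 hx) (Set.mem_Ici.2 (hx.trans h)) h

theorem ClassKInf.le_of_le {f : ℝ → ℝ} (hf : ClassKInf f) {x y : ℝ} (hx : 0 ≤ x) (hy : 0 ≤ y)
    (h : f x ≤ f y) : x ≤ y :=
  (hf.1.2.1.le_iff_le (Set.mem_Ici.2 hx) (Set.mem_Ici.2 hy)).1 h

theorem ClassKInf.comp {f g : ℝ → ℝ} (hf : ClassKInf f) (hg : ClassKInf g) :
    ClassKInf (fun x => f (g x)) := by
  have hm : Set.MapsTo g (Set.Ici 0) (Set.Ici 0) := fun x hx => hg.nonneg hx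
  refine ⟨⟨hf.1.1.comp hg.1.1 hm, fun x hx y hy hxy => ?_, ?_⟩, hf.2.comp hg.2⟩
  · exact hf.1.2.1 (hm hx) (hm hy) (hg.1.2.1 hx hy hxy)
  · simp only [hg.1.2.2, hf.1.2.2]

theorem ClassKInf.add_mul {f g : ℝ → ℝ} (hf : ClassKInf f) (hg : ClassKInf g) {t : ℝ}
    (ht : 0 ≤ t) : ClassKInf (fun x => f x + t * g x) := by
  refine ⟨⟨hf.1.1.add (continuousOn_const.mul hg.1.1), fun x hx y hy hxy => ?_, ?_⟩, ?_⟩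
  · have h1 := hf.1.2.1 hx hy hxy
    have h2 := mul_le_mul_of_nonneg_left (hg.mono hx hxy.le) ht
    show f x + t * g x < f y + t * g y
    linarith
  · simp only [hg.1.2.2, hf.1.2.2]; simp
  · refine Filter.tendsto_atTop_mono' _ ?_ hf.2
    filter_upwards [Filter.eventually_ge_atTop 0] with x hx
    have := mul_nonneg ht (hg.nonneg hx)
    linarith

theorem ClassKInf.exists_inv {f : ℝ → ℝ} (hf : ClassKInf f) :
    ∃ g : ℝ → ℝ, ClassKInf g ∧ (∀ y, 0 ≤ y → f (g y) = y) := by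
  let e : ℝ → ℝ := fun x => f (max x 0) + min x 0
  have hsm : StrictMono e := by
    intro x y hxy
    show f (max x 0) + min x 0 < f (max y 0) + min y 0
    rcases le_or_gt 0 x with hx | hx
    · have := hf.1.2.1 (Set.mem_Ici.2 hx) (Set.mem_Ici.2 (hx.trans hxy.le)) hxy
      rw [max_eq_left hx, max_eq_left (hx.trans hxy.le), min_eq_right hx,
        min_eq_right (hx.trans hxy.le)]
      linarith
    · have h1 : f (max x 0) ≤ f (max y 0) :=
        hf.mono (le_max_right _ _) (max_le_max hxy.le le_rfl)
      have h2 : min x 0 < min y 0 := by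
        rw [min_eq_left hx.le]; exact lt_min hxy hx
      linarith
  have hc : Continuous e := by
    refine Continuous.add ?_ (by fun_prop)
    exact hf.1.1.comp_continuous (by fun_prop) (fun x => Set.mem_Ici.2 (le_max_right _ _))
  have hpos : ∀ x, 0 ≤ x → e x = f x := by
    intro x hx
    show f (max x 0) + min x 0 = f x
    rw [max_eq_left hx, min_eq_right hx, add_zero]
  have hneg : ∀ x, x ≤ 0 → e x = x := by
    intro x hx
    show f (max x 0) + min x 0 = x
    rw [max_eq_right hx, min_eq_left hx, hf.1.2.2, zero_add]
  have htop : Filter.Tendsto e Filter.atTop Filter.atTop := by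
    refine hf.2.congr' ?_
    filter_upwards [Filter.eventually_ge_atTop 0] with x hx
    exact (hpos x hx).symm
  have hbot : Filter.Tendsto e Filter.atBot Filter.atBot := by
    refine Filter.tendsto_id.congr' ?_
    filter_upwards [Filter.eventually_le_atBot 0] with x hx
    exact (hneg x hx).symm
  have hsurj : Function.Surjective e := hc.surjective htop hbot
  let E : ℝ ≃o ℝ := hsm.orderIsoOfSurjective e hsurj
  have hE : ∀ x, E x = e x := fun x => rfl
  have h0 : E.symm 0 = 0 := by
    rw [OrderIso.symm_apply_eq, hE, hneg 0 le_rfl]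
  refine ⟨E.symm, ⟨⟨E.symm.continuous.continuousOn, E.symm.strictMono.strictMonoOn _, h0⟩,
    E.symm.tendsto_atTop⟩, fun y hy => ?_⟩
  have hy' : 0 ≤ E.symm y := by
    rw [← h0]; exact E.symm.monotone hy
  rw [← hpos _ hy', ← hE, OrderIso.apply_symm_apply]

theorem statement3 {n p : ℕ}
    (F : EuclideanSpace ℝ (Fin n) → EuclideanSpace ℝ (Fin p) → ℝ → EuclideanSpace ℝ (Fin n)) (D : ℝ) (hD : 0 < D)
    (h : ∃ α₁ α₂ α₃ : ℝ → ℝ, ClassKInf α₁ ∧ ClassKInf α₂ ∧ ClassKInf α₃ ∧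
      ∀ M, 0 ≤ M → ∃ Tstar, 0 < Tstar ∧
        ∃ V : EuclideanSpace ℝ (Fin n) → ENNReal,
          (∀ x : EuclideanSpace ℝ (Fin n), ENNReal.ofReal (α₁ ‖x‖) ≤ V x) ∧
          (∀ x : EuclideanSpace ℝ (Fin n), ‖x‖ ≤ M → V x ≤ ENNReal.ofReal (α₂ ‖x‖)) ∧
          (∀ (x : EuclideanSpace ℝ (Fin n)) (d : EuclideanSpace ℝ (Fin p)) (T : ℝ), ‖x‖ ≤ M → ‖d‖ ≤ D → 0 < T → T < Tstar →
            V (F x d T) + ENNReal.ofReal (T * α₃ ‖x‖) ≤ V x)) :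
    RSSVSR F D := by
  obtain ⟨α₁, α₂, α₃, h1, h2, h3, hV⟩ := h
  obtain ⟨g₁, hg₁, hg₁'⟩ := h1.exists_inv
  obtain ⟨g₂, hg₂, hg₂'⟩ := h2.exists_inv
  have hρ : ClassKInf (fun r => α₃ (g₂ (α₁ r))) := h3.comp (hg₂.comp h1)
  have hH : ∀ t : ℝ, 0 ≤ t → ClassKInf (fun r => α₁ r + t * α₃ (g₂ (α₁ r))) :=
    fun t ht => h1.add_mul hρ ht
  have hinv : ∀ t : ℝ, ∃ g : ℝ → ℝ, 0 ≤ t → ClassKInf g ∧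
      ∀ y, 0 ≤ y → α₁ (g y) + t * α₃ (g₂ (α₁ (g y))) = y := by
    intro t
    by_cases ht : 0 ≤ t
    · obtain ⟨g, hg, hg'⟩ := (hH t ht).exists_inv
      exact ⟨g, fun _ => ⟨hg, hg'⟩⟩
    · exact ⟨id, fun h => absurd h ht⟩
  choose g hg using hinv
  refine ⟨fun s t => g t (α₂ s), ⟨?_, ?_⟩, ?_⟩
  · intro t ht
    have := ((hg t ht).1.comp h2).1
    exact ⟨this.1, this.2.1, this.2.2⟩
  · intro s hs
    have hy := h2.pos hs
    refine ⟨?_, ?_⟩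
    · intro t ht u hu htu
      show g u (α₂ s) < g t (α₂ s)
      have e1 := (hg t ht).2 _ hy.le
      have e2 := (hg u hu).2 _ hy.le
      have p1 := (hg t ht).1.pos hy
      have p2 := (hg u hu).1.pos hy
      by_contra hcon
      push Not at hcon
      have m := (hH t ht).mono p1.le hcon
      have := mul_lt_mul_of_pos_right htu (hρ.pos p2)
      beta_reduce at m this
      linarith
    · rw [tendsto_order]
      refine ⟨fun a ha => ?_, fun ε hε => ?_⟩
      · filter_upwards [Filter.eventually_ge_atTop 0] with t ht
        exact ha.trans ((hg t ht).1.pos hy)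
      · have hp := hρ.pos hε
        filter_upwards [Filter.eventually_ge_atTop 0,
          Filter.eventually_gt_atTop (α₂ s / α₃ (g₂ (α₁ ε)))] with t ht ht'
        rw [div_lt_iff₀ hp] at ht'
        have e1 := (hg t ht).2 _ hy.le
        by_contra hcon
        push Not at hcon
        have m := (hH t ht).mono hε.le hcon
        have := h1.pos hε
        beta_reduce at m
        linarith
  · intro M hM
    have hαM := h2.nonneg hM
    have hgM : 0 ≤ g₁ (α₂ M) := hg₁.nonneg hαM
    set R := max M (g₁ (α₂ M)) with hR
    have hMR : M ≤ R := le_max_left _ _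
    have hR0 : 0 ≤ R := hM.trans hMR
    have hαR : α₂ M ≤ α₁ R := by
      have := h1.mono hgM (le_max_right M (g₁ (α₂ M)))
      rwa [hg₁' _ hαM] at this
    obtain ⟨Ts, hTs, V, hV1, hV2, hV3⟩ := hV R hR0
    refine ⟨Ts, hTs, ?_⟩
    intro x d T hx hx0 hT hd k
    have hb0 : V (x 0) ≤ ENNReal.ofReal (α₂ ‖x 0‖) := hV2 _ (hx0.trans hMR)
    have hbd : ∀ j, V (x j) ≤ ENNReal.ofReal (α₂ ‖x 0‖) → ‖x j‖ ≤ R := by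
      intro j hj
      have h4 := (hV1 (x j)).trans hj
      rw [ENNReal.ofReal_le_ofReal_iff (h2.nonneg (norm_nonneg _))] at h4
      have h5 := h2.mono (norm_nonneg _) hx0
      exact h1.le_of_le (norm_nonneg _) hR0 (by linarith)
    have hterm : ∀ i, 0 ≤ T i * α₃ ‖x i‖ :=
      fun i => mul_nonneg (hT i).1.le (h3.nonneg (norm_nonneg _))
    have hsum : ∀ j, V (x j) + ENNReal.ofReal (∑ i ∈ Finset.range j, T i * α₃ ‖x i‖)
        ≤ ENNReal.ofReal (α₂ ‖x 0‖) := by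
      intro j
      induction j with
      | zero => simpa using hb0
      | succ j ih =>
        have hj : ‖x j‖ ≤ R := hbd j (le_self_add.trans ih)
        have h6 := hV3 (x j) (d j) (T j) hj (hd j) (hT j).1 (hT j).2
        rw [← hx j] at h6
        rw [Finset.sum_range_succ, ENNReal.ofReal_add (Finset.sum_nonneg fun i _ => hterm i)
          (hterm j), add_comm (ENNReal.ofReal (∑ i ∈ Finset.range j, T i * α₃ ‖x i‖)), ← add_assoc]
        exact (add_le_add h6 le_rfl).trans ih
    have hR' : ∀ j, ‖x j‖ ≤ R := fun j => hbd j (le_self_add.trans (hsum j))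
    have hanti : Antitone (fun j => V (x j)) := by
      refine antitone_nat_of_succ_le fun j => ?_
      have h6 := hV3 (x j) (d j) (T j) (hR' j) (hd j) (hT j).1 (hT j).2
      rw [← hx j] at h6
      exact le_self_add.trans h6
    have hcmp : ∀ i, i ≤ k → g₂ (α₁ ‖x k‖) ≤ ‖x i‖ := by
      intro i hi
      have h7 := ((hV1 (x k)).trans (hanti hi)).trans (hV2 _ (hR' i))
      rw [ENNReal.ofReal_le_ofReal_iff (h2.nonneg (norm_nonneg _))] at h7
      have h8 := h1.nonneg (norm_nonneg (x k))
      refine h2.le_of_le (hg₂.nonneg h8) (norm_nonneg _) ?_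
      rwa [hg₂' _ h8]
    have h8 := h1.nonneg (norm_nonneg (x k))
    have hS : (∑ i ∈ Finset.range k, T i) * α₃ (g₂ (α₁ ‖x k‖))
        ≤ ∑ i ∈ Finset.range k, T i * α₃ ‖x i‖ := by
      rw [Finset.sum_mul]
      refine Finset.sum_le_sum fun i hi => ?_
      exact mul_le_mul_of_nonneg_left
        (h3.mono (hg₂.nonneg h8) (hcmp i (Finset.mem_range.1 hi).le)) (hT i).1.le
    have h9 := (add_le_add (hV1 (x k)) le_rfl).trans (hsum k)
    rw [← ENNReal.ofReal_add h8 (Finset.sum_nonneg fun i _ => hterm i),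
      ENNReal.ofReal_le_ofReal_iff (h2.nonneg (norm_nonneg _))] at h9
    have ht : 0 ≤ ∑ i ∈ Finset.range k, T i := Finset.sum_nonneg fun i _ => (hT i).1.le
    have hy := h2.nonneg (norm_nonneg (x 0))
    refine (hH _ ht).le_of_le (norm_nonneg _) ((hg _ ht).1.nonneg hy) ?_
    simp only
    rw [(hg _ ht).2 _ hy]
    linarith
end

section
/- If the system x_{k+1} = F̄(x_k, e_k, T_k) is S-ISS-VSR, then there exist functions α₁, α₂, α₃ of class K∞ and ρ of class K such that for every M ≥ 0 and E ≥ 0 there exist T̃ = T̃(M,E) > 0 and a function V = V_{M,E} : ℝⁿ → ℝ≥0 ∪ {∞} such that: α₁(|x|) ≤ V(x) for all x ∈ ℝⁿ; V(x) ≤ α₂(|x|) for all |x| ≤ M; and V(F̄(x,e,T)) − V(x) ≤ −T·α₃(|x|) for all x, e, T with ρ(|e|) ≤ |x| ≤ M, |e| ≤ E and T ∈ (0, T̃). -/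
open scoped BigOperators

/-- Semiglobal input-to-state stability under varying sampling rate (S-ISS-VSR) of
`x_{k+1} = F (x_k) (e_k) (T_k)`. -/
def SISSVSR {X Q : Type*} [NormedAddCommGroup X] [NormedAddCommGroup Q]
    (F : X → Q → ℝ → X) : Prop :=
  ∃ β : ℝ → ℝ → ℝ, ∃ γ : ℝ → ℝ, ClassKL β ∧ ClassKInf γ ∧
    ∀ M, 0 ≤ M → ∀ Eb, 0 ≤ Eb → ∃ Tstar, 0 < Tstar ∧
      ∀ (x : ℕ → X) (e : ℕ → Q) (T : ℕ → ℝ),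
        (∀ k, x (k + 1) = F (x k) (e k) (T k)) →
        ‖x 0‖ ≤ M → (∀ i, ‖e i‖ ≤ Eb) → (∀ i, 0 < T i ∧ T i < Tstar) →
        ∀ k, ‖x k‖ ≤ β ‖x 0‖ (∑ i ∈ Finset.range k, T i) +
          γ (⨆ i ∈ Finset.range k, ‖e i‖)

theorem aux_mono {f : ℝ → ℝ} (hf : ClassK f) {a b : ℝ} (ha : 0 ≤ a) (hab : a ≤ b) : f a ≤ f b :=
  hf.2.1.monotoneOn ha (Set.mem_Ici.2 (ha.trans hab)) hab

theorem aux_nonneg {f : ℝ → ℝ} (hf : ClassK f) {a : ℝ} (ha : 0 ≤ a) : 0 ≤ f a := by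
  have := aux_mono hf le_rfl ha
  rwa [hf.2.2] at this

theorem aux_comp {f g : ℝ → ℝ} (hf : ClassK f) (hg : ClassK g) : ClassK (fun s => f (g s)) := by
  have hm : Set.MapsTo g (Set.Ici 0) (Set.Ici 0) := fun a ha => aux_nonneg hg ha
  refine ⟨hf.1.comp hg.1 hm, fun a ha b hb hab => hf.2.1 (hm ha) (hm hb) (hg.2.1 ha hb hab), ?_⟩
  simp [hg.2.2, hf.2.2]

theorem aux_compInf {f g : ℝ → ℝ} (hf : ClassKInf f) (hg : ClassKInf g) :
    ClassKInf (fun s => f (g s)) :=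
  ⟨aux_comp hf.1 hg.1, hf.2.comp hg.2⟩

theorem aux_add {f g : ℝ → ℝ} (hf : ClassKInf f) (hg : ClassKInf g) :
    ClassKInf (fun s => f s + g s) := by
  refine ⟨⟨hf.1.1.add hg.1.1, fun a ha b hb hab =>
    add_lt_add (hf.1.2.1 ha hb hab) (hg.1.2.1 ha hb hab), ?_⟩, hf.2.atTop_add_atTop hg.2⟩
  simp [hf.1.2.2, hg.1.2.2]

theorem aux_id : ClassKInf (fun s => s) :=
  ⟨⟨continuousOn_id, strictMono_id.strictMonoOn _, rfl⟩, Filter.tendsto_id⟩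

/-- inverse of a `K∞` function -/
theorem aux_inv {f : ℝ → ℝ} (hf : ClassKInf f) :
    ∃ g, ClassKInf g ∧ (∀ s, 0 ≤ s → g (f s) = s) ∧ (∀ s, 0 ≤ s → f (g s) = s) := by
  obtain ⟨⟨hc, hm, h0⟩, ht⟩ := hf
  have hK : ClassK f := ⟨hc, hm, h0⟩
  let F : ℝ → ℝ := fun x => f (max x 0) + min x 0
  have hFc : Continuous F := by
    apply Continuous.add _ (by fun_prop)
    exact hc.comp_continuous (by fun_prop) (fun x => Set.mem_Ici.2 (le_max_right _ _))
  have hFpos : ∀ x, 0 ≤ x → F x = f x := by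
    intro x hx; simp [F, hx]
  have hFneg : ∀ x, x ≤ 0 → F x = x := by
    intro x hx; simp [F, hx, h0]
  have hFm : StrictMono F := by
    intro a b hab
    rcases le_or_gt 0 a with ha | ha
    · rw [hFpos a ha, hFpos b (ha.trans hab.le)]
      exact hm ha (Set.mem_Ici.2 (ha.trans hab.le)) hab
    · rw [hFneg a ha.le]
      rcases le_or_gt 0 b with hb | hb
      · rw [hFpos b hb]; exact ha.trans_le (aux_nonneg hK hb)
      · rwa [hFneg b hb.le]
  have hFs : Function.Surjective F := by
    apply hFc.surjective
    · refine ht.congr' ?_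
      filter_upwards [Filter.eventually_ge_atTop 0] with x hx using (hFpos x hx).symm
    · refine Filter.tendsto_id.congr' ?_
      filter_upwards [Filter.eventually_le_atBot 0] with x hx using (hFneg x hx).symm
  let e := hFm.orderIsoOfSurjective F hFs
  have he : ∀ x, e x = F x := fun x => rfl
  have e0 : e.symm 0 = 0 := by
    rw [OrderIso.symm_apply_eq, he, hFneg 0 le_rfl]
  refine ⟨e.symm, ⟨⟨e.symm.continuous.continuousOn, e.symm.strictMono.strictMonoOn _, e0⟩,
    e.symm.tendsto_atTop⟩, ?_, ?_⟩
  · intro s hs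
    rw [← hFpos s hs, ← he, OrderIso.symm_apply_apply]
  · intro s hs
    have : 0 ≤ e.symm s := by rw [← e0]; exact e.symm.monotone hs
    rw [← hFpos _ this, ← he, OrderIso.apply_symm_apply]

/-- a continuous monotone majorant for a settling time -/
theorem aux_A (β : ℝ → ℝ → ℝ) (hβ : ClassKL β) :
    ∃ A : ℝ → ℝ, Continuous A ∧ Monotone A ∧ (∀ s, 1 ≤ A s) ∧
      ∀ s, 0 < s → ∀ t, A s * A (1 / s) ≤ t → β s t ≤ s / 4 := by
  have h1 : ∀ m : ℕ, ∃ τ : ℝ, 0 ≤ τ ∧ β (m + 1) τ ≤ 1 / (4 * (m + 1)) := by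
    intro m
    have hm : (0 : ℝ) < m + 1 := by positivity
    have := (hβ.2 _ hm).2
    have h2 : ∀ᶠ t in Filter.atTop, β (m + 1) t < 1 / (4 * (m + 1)) :=
      this.eventually (gt_mem_nhds (by positivity))
    obtain ⟨t, ht, ht0⟩ := (h2.and (Filter.eventually_ge_atTop 0)).exists
    exact ⟨t, ht0, ht.le⟩
  choose τ hτ0 hτ using h1
  let a : ℕ → ℝ := fun m => 1 + ∑ i ∈ Finset.range (m + 1), τ i
  have ha : Monotone a := by
    intro m n hmn
    have : ∑ i ∈ Finset.range (m + 1), τ i ≤ ∑ i ∈ Finset.range (n + 1), τ i :=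
      Finset.sum_le_sum_of_subset_of_nonneg (Finset.range_mono (by omega)) (fun i _ _ => hτ0 i)
    simpa [a] using this
  have ha1 : ∀ m, 1 ≤ a m := fun m => by
    have := Finset.sum_nonneg (s := Finset.range (m + 1)) (fun i _ => hτ0 i)
    simpa [a] using this
  have haτ : ∀ m, τ m ≤ a m := fun m => by
    have := Finset.single_le_sum (s := Finset.range (m + 1)) (f := τ) (fun i _ => hτ0 i)
      (Finset.self_mem_range_succ m)
    simp only [a]; linarith
  let u : ℝ → ℝ := fun y => a ⌈y⌉₊
  have hu : Monotone u := fun x y hxy => ha (Nat.ceil_mono hxy)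
  have hui : ∀ x y, IntervalIntegrable u MeasureTheory.volume x y := fun x y => hu.intervalIntegrable
  let A : ℝ → ℝ := fun y => ∫ x in (0 : ℝ)..1, u (y + x)
  have hAi : ∀ y, IntervalIntegrable (fun x => u (y + x)) MeasureTheory.volume 0 1 := fun y => by
    have hmy : Monotone (fun x => u (y + x)) := fun p q hpq => hu (by linarith)
    exact hmy.intervalIntegrable
  have hAu : ∀ y, u y ≤ A y := by
    intro y
    have := intervalIntegral.integral_mono_on (a := 0) (b := 1) (μ := MeasureTheory.volume)
      (f := fun _ => u y) (g := fun x => u (y + x)) zero_le_one (by simp) (hAi y)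
      (fun x hx => hu (by linarith [hx.1]))
    rw [intervalIntegral.integral_const] at this
    simp only [sub_zero, one_smul] at this
    exact this
  have hA1 : ∀ y, 1 ≤ A y := fun y => (ha1 _).trans (hAu y)
  refine ⟨A, ?_, ?_, hA1, ?_⟩
  · have hP := intervalIntegral.continuous_primitive (μ := MeasureTheory.volume) hui 0
    have : A = fun y => (∫ x in (0 : ℝ)..(y + 1), u x) - ∫ x in (0 : ℝ)..y, u x := by
      funext y
      rw [intervalIntegral.integral_interval_sub_left (hui _ _) (hui _ _)]
      simp [A]
    rw [this]
    exact (hP.comp (continuous_id.add continuous_const)).sub hP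
  · intro p q hpq
    exact intervalIntegral.integral_mono_on zero_le_one (hAi p) (hAi q)
      (fun x _ => hu (by linarith))
  · intro s hs t ht
    have key : ∀ m : ℕ, s ≤ m + 1 → 1 / s ≤ m + 1 → τ m ≤ t → β s t ≤ s / 4 := by
      intro m h1 h2 h3
      have hm : (0 : ℝ) < m + 1 := by positivity
      have b1 : β s t ≤ β (m + 1) t :=
        (hβ.1 t ((hτ0 m).trans h3)).2.1.monotoneOn hs.le hm.le h1
      have b2 : β (m + 1) t ≤ β (m + 1) (τ m) :=
        (hβ.2 _ hm).1.antitoneOn (hτ0 m) (Set.mem_Ici.2 ((hτ0 m).trans h3)) h3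
      have b3 : 1 / (4 * ((m : ℝ) + 1)) ≤ s / 4 := by
        rw [div_le_iff₀ hs] at h2
        rw [div_le_div_iff₀ (by positivity) (by norm_num)]
        linarith
      linarith [hτ m]
    have p1 := hA1 s
    have p2 := hA1 (1 / s)
    rcases le_total s (1 / s) with h | h
    · refine key ⌈1 / s⌉₊ ?_ ?_ ?_
      · linarith [Nat.le_ceil (1 / s)]
      · linarith [Nat.le_ceil (1 / s)]
      · have := (haτ ⌈1 / s⌉₊).trans (hAu (1 / s))
        nlinarith
    · refine key ⌈s⌉₊ ?_ ?_ ?_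
      · linarith [Nat.le_ceil s]
      · linarith [Nat.le_ceil s]
      · have := (haτ ⌈s⌉₊).trans (hAu s)
        nlinarith

theorem aux_psi {A : ℝ → ℝ} (hc : Continuous A) (hm : Monotone A) (h1 : ∀ s, 1 ≤ A s) :
    ClassKInf (fun s => s / A (1 / s)) := by
  have hp : ∀ s, 0 < A s := fun s => one_pos.trans_le (h1 s)
  refine ⟨⟨?_, ?_, by simp⟩, ?_⟩
  · intro s hs
    rcases (Set.mem_Ici.1 hs).eq_or_lt with rfl | hs
    · have : Filter.Tendsto (fun s => s / A (1 / s)) (nhdsWithin 0 (Set.Ici 0)) (nhds 0) := by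
        refine tendsto_of_tendsto_of_tendsto_of_le_of_le' tendsto_const_nhds
          (Filter.tendsto_id.mono_left nhdsWithin_le_nhds : Filter.Tendsto (fun s : ℝ => s) _ _) ?_ ?_
        · filter_upwards [self_mem_nhdsWithin] with x hx using div_nonneg hx (hp _).le
        · filter_upwards [self_mem_nhdsWithin] with x hx using div_le_self hx (h1 _)
      simpa [ContinuousWithinAt] using this
    · apply ContinuousAt.continuousWithinAt
      refine continuousAt_id.div ?_ (hp _).ne'
      exact hc.continuousAt.comp (continuousAt_const.div continuousAt_id hs.ne')
  · intro a ha b hb hab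
    have ha : 0 ≤ a := ha
    rcases ha.eq_or_lt with rfl | ha
    · simp only [zero_div]; exact div_pos hab (hp _)
    · have := hm (one_div_le_one_div_of_le ha hab.le)
      exact div_lt_div₀ hab this (ha.trans hab).le (hp _)
  · refine Filter.tendsto_atTop_mono' _ ?_ (Filter.tendsto_id.atTop_div_const (hp 1))
    filter_upwards [Filter.eventually_ge_atTop 1] with s hs
    have : A (1 / s) ≤ A 1 := hm (by rw [div_le_one (by linarith)]; exact hs)
    exact div_le_div_of_nonneg_left (by simp; linarith) (hp _) this

theorem aux_W {A : ℝ → ℝ} (hc : Continuous A) (hm : Monotone A) (h1 : ∀ s, 1 ≤ A s) :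
    ClassKInf (fun s => 4 * s * A s) := by
  refine ⟨⟨by fun_prop, ?_, by simp⟩, ?_⟩
  · intro a ha b hb hab
    have ha : 0 ≤ a := ha
    have := hm hab.le
    have := h1 a
    simp only
    nlinarith
  · refine Filter.tendsto_atTop_mono' _ ?_ Filter.tendsto_id
    filter_upwards [Filter.eventually_ge_atTop 0] with s hs
    have := h1 s
    simp only [id]
    nlinarith

def AdmTraj {X Q : Type*} [NormedAddCommGroup X] [NormedAddCommGroup Q]
    (F : X → Q → ℝ → X) (ρ : ℝ → ℝ) (Eb Tt : ℝ) (x : ℕ → X) (e : ℕ → Q) (T : ℕ → ℝ) : Prop :=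
  (∀ k, x (k + 1) = F (x k) (e k) (T k)) ∧ (∀ i, ρ ‖e i‖ ≤ ‖x i‖) ∧ (∀ i, ‖e i‖ ≤ Eb) ∧
    ∀ i, 0 < T i ∧ T i < Tt

theorem aux_sup {Q : Type*} [NormedAddCommGroup Q] {γ : ℝ → ℝ} (hγ : ClassKInf γ)
    (e : ℕ → Q) (k : ℕ) (c : ℝ) (hc : 0 ≤ c) (h : ∀ i < k, γ ‖e i‖ ≤ c) :
    γ (⨆ i ∈ Finset.range k, ‖e i‖) ≤ c := by
  obtain ⟨g, hg, hgf, hfg⟩ := aux_inv hγ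
  have hg0 : 0 ≤ g c := aux_nonneg hg.1 hc
  rw [← hfg c hc]
  refine aux_mono hγ.1 (Real.iSup_nonneg fun i => Real.iSup_nonneg fun _ => norm_nonneg _) ?_
  refine Real.iSup_le (fun i => Real.iSup_le (fun hi => ?_) hg0) hg0
  rw [← hgf _ (norm_nonneg (e i))]
  exact aux_mono hg.1 (aux_nonneg hγ.1 (norm_nonneg _)) (h i (Finset.mem_range.1 hi))

section core
variable {X Q : Type*} [NormedAddCommGroup X] [NormedAddCommGroup Q]

theorem aux_bound (F : X → Q → ℝ → X) {β : ℝ → ℝ → ℝ} {γ σ ρ : ℝ → ℝ}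
    (hβ : ClassKL β) (hγ : ClassKInf γ) (hσ : ClassKInf σ)
    (hσβ : ∀ s, 0 ≤ s → σ s = β s 0 + s)
    (hρ : ∀ s, ρ s = 2 * σ (4 * γ s))
    {M Eb Tt : ℝ}
    (hS : ∀ (x : ℕ → X) (e : ℕ → Q) (T : ℕ → ℝ),
        (∀ k, x (k + 1) = F (x k) (e k) (T k)) →
        ‖x 0‖ ≤ M → (∀ i, ‖e i‖ ≤ Eb) → (∀ i, 0 < T i ∧ T i < Tt) →
        ∀ k, ‖x k‖ ≤ β ‖x 0‖ (∑ i ∈ Finset.range k, T i) +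
          γ (⨆ i ∈ Finset.range k, ‖e i‖))
    (x : ℕ → X) (e : ℕ → Q) (T : ℕ → ℝ) (hA : AdmTraj F ρ Eb Tt x e T) (hM : ‖x 0‖ ≤ M) :
    (∀ k, ‖x k‖ ≤ 2 * σ ‖x 0‖) ∧
    (∀ k, β ‖x 0‖ (∑ i ∈ Finset.range k, T i) ≤ ‖x 0‖ / 4 → ‖x k‖ ≤ ‖x 0‖ / 2) := by
  obtain ⟨h1, h2, h3, h4⟩ := hA
  have hb0 : ∀ s, 0 ≤ s → 0 ≤ β s 0 := fun s hs => aux_nonneg (hβ.1 0 le_rfl) hs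
  have hγ0 : ∀ i, 0 ≤ γ ‖e i‖ := fun i => aux_nonneg hγ.1 (norm_nonneg _)
  have hσ0 : 0 ≤ σ ‖x 0‖ := aux_nonneg hσ.1 (norm_nonneg _)
  have hx0 := norm_nonneg (x 0)
  have hg : ∀ i, 8 * γ ‖e i‖ ≤ ‖x i‖ := by
    intro i
    have a := h2 i
    have b := hγ0 i
    rw [hρ, hσβ _ (by linarith)] at a
    have := hb0 (4 * γ ‖e i‖) (by linarith)
    linarith
  have c1 : ∀ k, ‖x k‖ ≤ 2 * σ ‖x 0‖ := by
    intro k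
    induction k using Nat.strong_induction_on with
    | _ k ih =>
      have a := hS x e T h1 hM h3 h4 k
      have b : γ (⨆ i ∈ Finset.range k, ‖e i‖) ≤ σ ‖x 0‖ / 4 :=
        aux_sup hγ e k _ (by linarith) (fun i hi => by linarith [ih i hi, hg i])
      have c : β ‖x 0‖ (∑ i ∈ Finset.range k, T i) ≤ β ‖x 0‖ 0 := by
        have ht : 0 ≤ ∑ i ∈ Finset.range k, T i := Finset.sum_nonneg fun i _ => (h4 i).1.le
        rcases hx0.eq_or_lt with h | h
        · rw [← h, (hβ.1 _ ht).2.2, (hβ.1 _ le_rfl).2.2]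
        · exact (hβ.2 _ h).1.antitoneOn (Set.mem_Ici.2 le_rfl) ht ht
      have d := hσβ ‖x 0‖ hx0
      linarith
  refine ⟨c1, fun k hk => ?_⟩
  have a := hS x e T h1 hM h3 h4 k
  have b : γ (⨆ i ∈ Finset.range k, ‖e i‖) ≤ ‖x 0‖ / 4 := by
    refine aux_sup hγ e k _ (by linarith) (fun i hi => ?_)
    have u := (h2 i).trans (c1 i)
    rw [hρ] at u
    have v : σ (4 * γ ‖e i‖) ≤ σ ‖x 0‖ := by linarith
    have w := (hσ.1.2.1.le_iff_le (Set.mem_Ici.2 (by linarith [hγ0 i])) hx0).1 v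
    linarith
  linarith

theorem aux_sum (F : X → Q → ℝ → X) {β : ℝ → ℝ → ℝ} {γ σ ρ α A : ℝ → ℝ}
    (hβ : ClassKL β) (hγ : ClassKInf γ) (hσ : ClassKInf σ)
    (hσβ : ∀ s, 0 ≤ s → σ s = β s 0 + s)
    (hρ : ∀ s, ρ s = 2 * σ (4 * γ s)) (hα : ClassKInf α)
    (hm : Monotone A) (hA1 : ∀ s, 1 ≤ A s)
    (hAβ : ∀ s, 0 < s → ∀ t, A s * A (1 / s) ≤ t → β s t ≤ s / 4)
    (hαA : ∀ s, 0 ≤ s → α (2 * σ s) = s / A (1 / s))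
    {M Eb Tt : ℝ} (hTt : Tt ≤ 1)
    (hS : ∀ (x : ℕ → X) (e : ℕ → Q) (T : ℕ → ℝ),
        (∀ k, x (k + 1) = F (x k) (e k) (T k)) →
        ‖x 0‖ ≤ M → (∀ i, ‖e i‖ ≤ Eb) → (∀ i, 0 < T i ∧ T i < Tt) →
        ∀ k, ‖x k‖ ≤ β ‖x 0‖ (∑ i ∈ Finset.range k, T i) +
          γ (⨆ i ∈ Finset.range k, ‖e i‖)) (k : ℕ) :
    ∀ (x : ℕ → X) (e : ℕ → Q) (T : ℕ → ℝ), AdmTraj F ρ Eb Tt x e T → ‖x 0‖ ≤ M →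
    ∑ i ∈ Finset.range k, T i * α ‖x i‖ ≤ 4 * ‖x 0‖ * A ‖x 0‖ := by
  induction k using Nat.strong_induction_on with
  | _ k ih =>
  intro x e T hadm hM
  obtain ⟨B1, B2⟩ := aux_bound F hβ hγ hσ hσβ hρ hS x e T hadm hM
  have hadm' := hadm
  obtain ⟨h1, h2, h3, h4⟩ := hadm'
  set s := ‖x 0‖ with hs_def
  have hs : 0 ≤ s := norm_nonneg _
  have hαb : ∀ i, α ‖x i‖ ≤ s / A (1 / s) := fun i => by
    rw [← hαA s hs]; exact aux_mono hα.1 (norm_nonneg _) (B1 i)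
  have hps : 0 ≤ s / A (1 / s) := div_nonneg hs (by linarith [hA1 (1 / s)])
  -- partial sums
  have hpart : ∀ j, ∑ i ∈ Finset.range j, T i * α ‖x i‖ ≤
      (∑ i ∈ Finset.range j, T i) * (s / A (1 / s)) := by
    intro j
    rw [Finset.sum_mul]
    exact Finset.sum_le_sum fun i _ => mul_le_mul_of_nonneg_left (hαb i) (h4 i).1.le
  rcases hs.eq_or_lt with h0 | hs0
  · have := hpart k
    rw [← h0] at this ⊢
    simpa using this
  have hAs := hA1 s
  have hAi := hA1 (1 / s)
  have hD : A s * A (1 / s) * (s / A (1 / s)) = s * A s := by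
    field_simp
  have hD1 : 1 ≤ A s * A (1 / s) := by nlinarith
  have hbig : ∀ j, ∑ i ∈ Finset.range j, T i ≤ 2 * (A s * A (1 / s)) →
      ∑ i ∈ Finset.range j, T i * α ‖x i‖ ≤ 2 * s * A s := by
    intro j hj
    have := mul_le_mul_of_nonneg_right hj hps
    have := hpart j
    nlinarith
  by_cases hex : ∃ j, A s * A (1 / s) ≤ ∑ i ∈ Finset.range j, T i
  · classical
    let j := Nat.find hex
    have hj : A s * A (1 / s) ≤ ∑ i ∈ Finset.range j, T i := Nat.find_spec hex
    have hjmin : ∀ m < j, ∑ i ∈ Finset.range m, T i < A s * A (1 / s) := fun m hmj =>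
      not_le.1 (Nat.find_min hex hmj)
    have hj0 : j ≠ 0 := by
      intro h; rw [h, Finset.sum_range_zero] at hj; linarith
    by_cases hjk : j ≤ k
    · obtain ⟨m, hjm⟩ := Nat.exists_eq_succ_of_ne_zero hj0
      have hjt : ∑ i ∈ Finset.range j, T i ≤ 2 * (A s * A (1 / s)) := by
        have a := hjmin m (by omega)
        rw [hjm, Finset.sum_range_succ]
        linarith [(h4 m).2]
      have hfirst := hbig j hjt
      have hxj := B2 j (hAβ s hs0 _ hj)
      have hrest := ih (k - j) (by omega) (fun i => x (j + i)) (fun i => e (j + i))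
        (fun i => T (j + i)) ⟨fun i => h1 (j + i), fun i => h2 (j + i), fun i => h3 (j + i),
          fun i => h4 (j + i)⟩ (by simp only [add_zero]; linarith)
      simp only [add_zero] at hrest
      have hsplit : ∑ i ∈ Finset.range k, T i * α ‖x i‖ = ∑ i ∈ Finset.range j, T i * α ‖x i‖ +
          ∑ i ∈ Finset.range (k - j), T (j + i) * α ‖x (j + i)‖ := by
        rw [← Finset.sum_range_add]
        congr 2; omega
      have hAx : A ‖x j‖ ≤ A s := hm (by linarith)
      have : 4 * ‖x j‖ * A ‖x j‖ ≤ 2 * s * A s := by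
        have := norm_nonneg (x j)
        have := hA1 ‖x j‖
        nlinarith
      rw [hsplit]; linarith
    · have := hbig k (by linarith [hjmin k (by omega)])
      nlinarith
  · push Not at hex
    have := hbig k (by linarith [hex k])
    nlinarith

end core

theorem statement7 {n q : ℕ}
    (F : EuclideanSpace ℝ (Fin n) → EuclideanSpace ℝ (Fin q) → ℝ → EuclideanSpace ℝ (Fin n))
    (h : SISSVSR F) :
    ∃ α₁ α₂ α₃ ρ : ℝ → ℝ, ClassKInf α₁ ∧ ClassKInf α₂ ∧ ClassKInf α₃ ∧ ClassK ρ ∧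
      ∀ M, 0 ≤ M → ∀ Eb, 0 ≤ Eb → ∃ Tt, 0 < Tt ∧
        ∃ V : EuclideanSpace ℝ (Fin n) → ENNReal,
          (∀ x : EuclideanSpace ℝ (Fin n), ENNReal.ofReal (α₁ ‖x‖) ≤ V x) ∧
          (∀ x : EuclideanSpace ℝ (Fin n), ‖x‖ ≤ M → V x ≤ ENNReal.ofReal (α₂ ‖x‖)) ∧
          (∀ (x : EuclideanSpace ℝ (Fin n)) (e : EuclideanSpace ℝ (Fin q)) (T : ℝ),
            ρ ‖e‖ ≤ ‖x‖ → ‖x‖ ≤ M → ‖e‖ ≤ Eb → 0 < T → T < Tt →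
            V (F x e T) + ENNReal.ofReal (T * α₃ ‖x‖) ≤ V x) := by
  obtain ⟨β, γ, hβ, hγ, hS⟩ := h
  obtain ⟨A, hAc, hAm, hA1, hAβ⟩ := aux_A β hβ
  have hlin : ∀ c : ℝ, 0 < c → ClassKInf (fun s => c * s) := fun c hc =>
    ⟨⟨by fun_prop, (strictMono_mul_left_of_pos hc).strictMonoOn _, by simp⟩,
      Filter.tendsto_id.const_mul_atTop hc⟩
  have hσ : ClassKInf (fun s => β s 0 + s) := by
    have hb := hβ.1 0 le_rfl
    refine ⟨⟨hb.1.add continuousOn_id, fun a ha b hb' hab =>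
      add_lt_add (hb.2.1 ha hb' hab) hab, by simp [hb.2.2]⟩, ?_⟩
    refine Filter.tendsto_atTop_mono' _ ?_ Filter.tendsto_id
    filter_upwards [Filter.eventually_ge_atTop 0] with s hs
    have : 0 ≤ β s 0 := aux_nonneg hb hs
    simpa using this
  have h2σ : ClassKInf (fun s => 2 * (β s 0 + s)) := aux_compInf (hlin 2 two_pos) hσ
  obtain ⟨g, hg, hgf, -⟩ := aux_inv h2σ
  have hα : ClassKInf (fun s => g s / A (1 / g s)) := aux_compInf (aux_psi hAc hAm hA1) hg
  have hρ : ClassKInf (fun s => 2 * (β (4 * γ s) 0 + 4 * γ s)) :=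
    aux_compInf (f := fun s => 2 * (β s 0 + s)) (g := fun s => 4 * γ s) h2σ
      (aux_compInf (hlin 4 four_pos) hγ)
  have hα2 := aux_add (aux_W hAc hAm hA1) h2σ
  refine ⟨fun s => s, _, _, _, aux_id, hα2, hα, hρ.1, ?_⟩
  intro M hM Eb hEb
  obtain ⟨Ts, hTs, hS⟩ := hS M hM Eb hEb
  set ρ : ℝ → ℝ := fun s => 2 * (β (4 * γ s) 0 + 4 * γ s) with hρdef
  set α : ℝ → ℝ := fun s => g s / A (1 / g s) with hαdef
  have hTt : 0 < min Ts 1 := lt_min hTs one_pos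
  refine ⟨min Ts 1, hTt, fun y => sSup {v | ∃ x e T k, AdmTraj F ρ Eb (min Ts 1) x e T ∧ x 0 = y ∧
    v = ENNReal.ofReal (∑ i ∈ Finset.range k, T i * α ‖x i‖ + ‖x k‖)}, ?_⟩
  have hS' : ∀ (x : ℕ → EuclideanSpace ℝ (Fin n)) (e : ℕ → EuclideanSpace ℝ (Fin q)) (T : ℕ → ℝ),
        (∀ k, x (k + 1) = F (x k) (e k) (T k)) →
        ‖x 0‖ ≤ M → (∀ i, ‖e i‖ ≤ Eb) → (∀ i, 0 < T i ∧ T i < min Ts 1) →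
        ∀ k, ‖x k‖ ≤ β ‖x 0‖ (∑ i ∈ Finset.range k, T i) +
          γ (⨆ i ∈ Finset.range k, ‖e i‖) := fun x e T a b c d =>
    hS x e T a b c (fun i => ⟨(d i).1, (d i).2.trans_le (min_le_left _ _)⟩)
  have hex : ∀ y, ∃ x e T, AdmTraj F ρ Eb (min Ts 1) x e T ∧ x 0 = y := by
    intro y
    refine ⟨fun k => Nat.rec y (fun _ z => F z 0 (min Ts 1 / 2)) k, fun _ => 0,
      fun _ => min Ts 1 / 2, ⟨fun k => rfl, fun i => ?_, fun i => by simpa using hEb,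
        fun i => ⟨by linarith, by linarith⟩⟩, rfl⟩
    rw [norm_zero, hρ.1.2.2]
    exact norm_nonneg _
  refine ⟨?_, ?_, ?_⟩
  · intro y
    obtain ⟨x, e, T, hadm, hy⟩ := hex y
    exact le_sSup ⟨x, e, T, 0, hadm, hy, by simp [hy]⟩
  · intro y hy
    refine sSup_le ?_
    rintro v ⟨x, e, T, k, hadm, rfl, rfl⟩
    apply ENNReal.ofReal_le_ofReal
    have a := aux_sum F (α := α) hβ hγ hσ (fun s _ => rfl) (fun s => rfl) hα hAm hA1 hAβ
      (fun s hs => by simp only [hαdef]; rw [hgf s hs]) (min_le_right _ _) hS' k x e T hadm hy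
    have b := (aux_bound F hβ hγ hσ (fun s _ => rfl) (fun s => rfl) hS' x e T hadm hy).1 k
    exact add_le_add a b
  · intro y e0 T0 hρe hyM he hT0 hT1
    obtain ⟨x, e, T, hadm, hy⟩ := hex (F y e0 T0)
    have hne : {v | ∃ x e T k, AdmTraj F ρ Eb (min Ts 1) x e T ∧ x 0 = F y e0 T0 ∧
        v = ENNReal.ofReal (∑ i ∈ Finset.range k, T i * α ‖x i‖ + ‖x k‖)}.Nonempty :=
      ⟨_, x, e, T, 0, hadm, hy, rfl⟩
    simp only
    rw [ENNReal.sSup_add hne]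
    refine iSup₂_le ?_
    clear hadm hy x e T
    rintro v ⟨x, e, T, k, ⟨h1, h2, h3, h4⟩, hy, rfl⟩
    have hα0 : ∀ z : EuclideanSpace ℝ (Fin n), 0 ≤ α ‖z‖ := fun z => aux_nonneg hα.1 (norm_nonneg _)
    rw [← ENNReal.ofReal_add (add_nonneg (Finset.sum_nonneg fun i _ =>
      mul_nonneg (h4 i).1.le (hα0 _)) (norm_nonneg _)) (mul_nonneg hT0.le (hα0 _))]
    refine le_sSup ⟨fun i => Nat.casesOn i y x, fun i => Nat.casesOn i e0 e,
      fun i => Nat.casesOn i T0 T, k + 1, ⟨?_, ?_, ?_, ?_⟩, rfl, ?_⟩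
    · rintro (_ | i)
      · exact hy
      · exact h1 i
    · rintro (_ | i)
      · exact hρe
      · exact h2 i
    · rintro (_ | i)
      · exact he
      · exact h3 i
    · rintro (_ | i)
      · exact ⟨hT0, hT1⟩
      · exact h4 i
    · rw [Finset.sum_range_succ']
      congr 1
      exact add_right_comm _ _ _
end

section
/- If the system x_{k+1} = F̄(x_k, e_k, T_k) is S-ISS-VSR with KL function β, K∞ function γ and a function T* : ℝ≥0 × ℝ≥0 → ℝ>0, then there exists a function T*' : ℝ≥0 × ℝ≥0 → ℝ>0, nonincreasing in each variable, such that the S-ISS-VSR estimate holds with the same β, γ and T*', i.e., for every M ≥ 0 and E ≥ 0, every solution with |x_0| ≤ M, ‖{e_i}‖ ≤ E and {T_i} ∈ Φ(T*'(M,E)) satisfies |x_k| ≤ β(|x_0|, Σ_{i=0}^{k-1} T_i) + γ(sup_{0≤i≤k-1} |e_i|) for all k ∈ ℕ₀. -/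
open scoped BigOperators

theorem statement10 {n q : ℕ}
    (F : EuclideanSpace ℝ (Fin n) → EuclideanSpace ℝ (Fin q) → ℝ → EuclideanSpace ℝ (Fin n))
    (β : ℝ → ℝ → ℝ) (γ : ℝ → ℝ) (hβ : ClassKL β) (hγ : ClassKInf γ)
    (Ts : ℝ → ℝ → ℝ) (hTs : ∀ M, 0 ≤ M → ∀ Eb, 0 ≤ Eb → 0 < Ts M Eb)
    (h : ∀ M, 0 ≤ M → ∀ Eb, 0 ≤ Eb →
      ∀ (x : ℕ → EuclideanSpace ℝ (Fin n)) (e : ℕ → EuclideanSpace ℝ (Fin q)) (T : ℕ → ℝ),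
        (∀ k, x (k + 1) = F (x k) (e k) (T k)) →
        ‖x 0‖ ≤ M → (∀ i, ‖e i‖ ≤ Eb) → (∀ i, 0 < T i ∧ T i < Ts M Eb) →
        ∀ k, ‖x k‖ ≤ β ‖x 0‖ (∑ i ∈ Finset.range k, T i) +
          γ (⨆ i ∈ Finset.range k, ‖e i‖)) :
    ∃ Ts' : ℝ → ℝ → ℝ,
      (∀ M, 0 ≤ M → ∀ Eb, 0 ≤ Eb → 0 < Ts' M Eb) ∧
      (∀ M₁ M₂ E₁ E₂, 0 ≤ M₁ → M₁ ≤ M₂ → 0 ≤ E₁ → E₁ ≤ E₂ → Ts' M₂ E₂ ≤ Ts' M₁ E₁) ∧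
      ∀ M, 0 ≤ M → ∀ Eb, 0 ≤ Eb →
        ∀ (x : ℕ → EuclideanSpace ℝ (Fin n)) (e : ℕ → EuclideanSpace ℝ (Fin q)) (T : ℕ → ℝ),
          (∀ k, x (k + 1) = F (x k) (e k) (T k)) →
          ‖x 0‖ ≤ M → (∀ i, ‖e i‖ ≤ Eb) → (∀ i, 0 < T i ∧ T i < Ts' M Eb) →
          ∀ k, ‖x k‖ ≤ β ‖x 0‖ (∑ i ∈ Finset.range k, T i) +
            γ (⨆ i ∈ Finset.range k, ‖e i‖) := by
  have hne : ∀ a b : ℕ, (Finset.range (a + 1) ×ˢ Finset.range (b + 1)).Nonempty := fun a b =>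
    ⟨(0, 0), by simp⟩
  refine ⟨fun M Eb => (Finset.range (⌈M⌉₊ + 1) ×ˢ Finset.range (⌈Eb⌉₊ + 1)).inf' (hne _ _)
    (fun p => Ts (p.1 : ℝ) (p.2 : ℝ)), ?_, ?_, ?_⟩
  · intro M _ Eb _
    rw [Finset.lt_inf'_iff]
    intro p _
    exact hTs _ (Nat.cast_nonneg _) _ (Nat.cast_nonneg _)
  · intro M₁ M₂ E₁ E₂ _ hM _ hE
    apply Finset.inf'_mono
    apply Finset.product_subset_product
    · exact Finset.range_mono (Nat.succ_le_succ (Nat.ceil_mono hM))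
    · exact Finset.range_mono (Nat.succ_le_succ (Nat.ceil_mono hE))
  · intro M _ Eb _ x e T hx h0 he hT
    refine h (⌈M⌉₊ : ℝ) (Nat.cast_nonneg _) (⌈Eb⌉₊ : ℝ) (Nat.cast_nonneg _) x e T hx
      (h0.trans (Nat.le_ceil _)) (fun i => (he i).trans (Nat.le_ceil _)) (fun i => ⟨(hT i).1, ?_⟩)
    refine (hT i).2.trans_le ?_
    exact Finset.inf'_le (fun p : ℕ × ℕ => Ts (p.1 : ℝ) (p.2 : ℝ))
      (b := (⌈M⌉₊, ⌈Eb⌉₊)) (by simp)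
end

section
/- Suppose the system x_{k+1} = F̄(x_k, e_k, T_k) is S-ISS-VSR with data (β₀, γ₀, T*), where β₀ is of class KL, γ₀ is of class K∞ and T* : ℝ≥0 × ℝ≥0 → ℝ>0 is nonincreasing in each variable. Define β(s,t) := 2β₀(s,t), γ(s) := 2γ₀(s), α(s) := β(s,0) = 2β₀(s,0), and let σ be the K∞ function satisfying γ(σ(s)) = α⁻¹(s)/2 for all s ≥ 0 (where α⁻¹ denotes the inverse of α). Then for every M ≥ 0, setting T̄(M) := T*(M, γ⁻¹(M/2)) > 0, every solution of the modified system x_{k+1} = F̄(x_k, σ(|x_k|)·d_k, T_k) with |x_0| ≤ M, {T_i} ∈ Φ(T̄(M)) and any sequence {d_i} ⊂ ℝ^q with |d_i| ≤ 1 for all i, satisfies |x_k| ≤ α(|x_0|) for all k ∈ ℕ₀, and moreover |x_k| ≤ max{β(|x_0|, Σ_{i=0}^{k-1} T_i), |x_0|/2} for all k ≥ 1. -/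
open scoped BigOperators

theorem statement11 {n q : ℕ}
    (F : EuclideanSpace ℝ (Fin n) → EuclideanSpace ℝ (Fin q) → ℝ → EuclideanSpace ℝ (Fin n))
    (β₀ : ℝ → ℝ → ℝ) (γ₀ : ℝ → ℝ) (hβ₀ : ClassKL β₀) (hγ₀ : ClassKInf γ₀)
    (Ts : ℝ → ℝ → ℝ) (hTs : ∀ M, 0 ≤ M → ∀ Eb, 0 ≤ Eb → 0 < Ts M Eb)
    (hTsmono : ∀ M₁ M₂ E₁ E₂, 0 ≤ M₁ → M₁ ≤ M₂ → 0 ≤ E₁ → E₁ ≤ E₂ → Ts M₂ E₂ ≤ Ts M₁ E₁)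
    (hSISS : ∀ M, 0 ≤ M → ∀ Eb, 0 ≤ Eb →
      ∀ (x : ℕ → EuclideanSpace ℝ (Fin n)) (e : ℕ → EuclideanSpace ℝ (Fin q)) (T : ℕ → ℝ),
        (∀ k, x (k + 1) = F (x k) (e k) (T k)) →
        ‖x 0‖ ≤ M → (∀ i, ‖e i‖ ≤ Eb) → (∀ i, 0 < T i ∧ T i < Ts M Eb) →
        ∀ k, ‖x k‖ ≤ β₀ ‖x 0‖ (∑ i ∈ Finset.range k, T i) +
          γ₀ (⨆ i ∈ Finset.range k, ‖e i‖))
    (αinv γinv σ : ℝ → ℝ)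
    (hαinv : ClassKInf αinv) (hγinv : ClassKInf γinv) (hσ : ClassKInf σ)
    (hαinv' : ∀ s, 0 ≤ s → αinv (2 * β₀ s 0) = s ∧ 2 * β₀ (αinv s) 0 = s)
    (hγinv' : ∀ s, 0 ≤ s → γinv (2 * γ₀ s) = s ∧ 2 * γ₀ (γinv s) = s)
    (hσ' : ∀ s, 0 ≤ s → 2 * γ₀ (σ s) = αinv s / 2) :
    ∀ M, 0 ≤ M →
      0 < Ts M (γinv (M / 2)) ∧
      ∀ (x : ℕ → EuclideanSpace ℝ (Fin n)) (d : ℕ → EuclideanSpace ℝ (Fin q)) (T : ℕ → ℝ),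
        (∀ k, x (k + 1) = F (x k) (σ ‖x k‖ • d k) (T k)) →
        ‖x 0‖ ≤ M → (∀ i, ‖d i‖ ≤ 1) → (∀ i, 0 < T i ∧ T i < Ts M (γinv (M / 2))) →
        (∀ k, ‖x k‖ ≤ 2 * β₀ ‖x 0‖ 0) ∧
        (∀ k, 1 ≤ k →
          ‖x k‖ ≤ max (2 * β₀ ‖x 0‖ (∑ i ∈ Finset.range k, T i)) (‖x 0‖ / 2)) := by
  intro M hM
  have hγm : MonotoneOn γ₀ (Set.Ici 0) := hγ₀.1.2.1.monotoneOn
  have hgm : MonotoneOn γinv (Set.Ici 0) := hγinv.1.2.1.monotoneOn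
  have hσm : MonotoneOn σ (Set.Ici 0) := hσ.1.2.1.monotoneOn
  have hg0 : ∀ s, 0 ≤ s → 0 ≤ γinv s := by
    intro s hs
    have := hgm (Set.mem_Ici.2 le_rfl) (Set.mem_Ici.2 hs) hs
    rwa [hγinv.1.2.2] at this
  have hσ0 : ∀ s, 0 ≤ s → 0 ≤ σ s := by
    intro s hs
    have := hσm (Set.mem_Ici.2 le_rfl) (Set.mem_Ici.2 hs) hs
    rwa [hσ.1.2.2] at this
  refine ⟨hTs M hM _ (hg0 _ (by positivity)), ?_⟩
  intro x d T hx hx0 hd hT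
  have hn : 0 ≤ ‖x 0‖ := norm_nonneg _
  have hb0 : 0 ≤ β₀ ‖x 0‖ 0 := by
    have h := hβ₀.1 0 le_rfl
    have := h.2.1.monotoneOn (Set.mem_Ici.2 le_rfl) (Set.mem_Ici.2 hn) hn
    simpa [h.2.2] using this
  have hbt : ∀ t, 0 ≤ t → β₀ ‖x 0‖ t ≤ β₀ ‖x 0‖ 0 := by
    intro t ht
    rcases hn.eq_or_lt with h | h
    · rw [← h, (hβ₀.1 t ht).2.2, (hβ₀.1 0 le_rfl).2.2]
    · exact (hβ₀.2 _ h).1.antitoneOn (Set.mem_Ici.2 le_rfl) (Set.mem_Ici.2 ht) ht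
  have hS : ∀ k, 0 ≤ ∑ i ∈ Finset.range k, T i :=
    fun k => Finset.sum_nonneg fun i _ => (hT i).1.le
  -- the error bound
  have hE : σ (2 * β₀ ‖x 0‖ 0) = γinv (‖x 0‖ / 2) := by
    have h1 := hσ' (2 * β₀ ‖x 0‖ 0) (by positivity)
    rw [(hαinv' _ hn).1] at h1
    rw [← h1, (hγinv' _ (hσ0 _ (by positivity))).1]
  have hEM : γinv (‖x 0‖ / 2) ≤ γinv (M / 2) :=
    hgm (Set.mem_Ici.2 (by positivity)) (Set.mem_Ici.2 (by positivity)) (by linarith)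
  have hE0 := hg0 (‖x 0‖ / 2) (by positivity)
  have step : ∀ k, (∀ j, j < k → ‖x j‖ ≤ 2 * β₀ ‖x 0‖ 0) →
      ‖x k‖ ≤ β₀ ‖x 0‖ (∑ i ∈ Finset.range k, T i) + ‖x 0‖ / 4 := by
    intro k hk
    let e : ℕ → EuclideanSpace ℝ (Fin q) := fun i => if i < k then σ ‖x i‖ • d i else 0
    let y : ℕ → EuclideanSpace ℝ (Fin n) := fun m => Nat.rec (x 0) (fun i z => F z (e i) (T i)) m
    have hy : ∀ i, y (i + 1) = F (y i) (e i) (T i) := fun i => rfl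
    have hyx : ∀ i, i ≤ k → y i = x i := by
      intro i
      induction i with
      | zero => intro _; rfl
      | succ i ih =>
        intro hi
        have hi' : i < k := hi
        rw [hy, ih hi'.le, hx]
        simp only [e, if_pos hi']
    have he : ∀ i, ‖e i‖ ≤ γinv (‖x 0‖ / 2) := by
      intro i
      by_cases hi : i < k
      · simp only [e, if_pos hi]
        rw [norm_smul, Real.norm_eq_abs, abs_of_nonneg (hσ0 _ (norm_nonneg _)), ← hE]
        have h1 := hσm (Set.mem_Ici.2 (norm_nonneg (x i)))
          (Set.mem_Ici.2 (by positivity : 0 ≤ 2 * β₀ ‖x 0‖ 0)) (hk i hi)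
        have h2 := mul_le_of_le_one_right (hσ0 _ (norm_nonneg (x i))) (hd i)
        linarith
      · simpa only [e, if_neg hi, norm_zero] using hE0
    have main := hSISS M hM (γinv (M / 2)) (hE0.trans hEM) y e T hy hx0
      (fun i => (he i).trans hEM) hT k
    rw [hyx k le_rfl, hyx 0 (Nat.zero_le _)] at main
    have hs0 : 0 ≤ ⨆ i ∈ Finset.range k, ‖e i‖ :=
      Real.iSup_nonneg fun i => Real.iSup_nonneg fun _ => norm_nonneg _
    have hs1 : (⨆ i ∈ Finset.range k, ‖e i‖) ≤ γinv (‖x 0‖ / 2) :=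
      Real.iSup_le (fun i => Real.iSup_le (fun _ => he i) hE0) hE0
    have h3 := hγm (Set.mem_Ici.2 hs0) (Set.mem_Ici.2 hE0) hs1
    have h4 := (hγinv' (‖x 0‖ / 2) (by positivity)).2
    linarith
  have h0 := step 0 (fun j hj => absurd hj (Nat.not_lt_zero j))
  simp only [Finset.range_zero, Finset.sum_empty] at h0
  have bd : ∀ k, ‖x k‖ ≤ 2 * β₀ ‖x 0‖ 0 := by
    intro k
    induction k using Nat.strong_induction_on with
    | _ k ih =>
      have h1 := step k ih
      have h2 := hbt _ (hS k)
      linarith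
  refine ⟨bd, fun k _ => ?_⟩
  have h1 := step k (fun j _ => bd j)
  have h2 := le_max_left (2 * β₀ ‖x 0‖ (∑ i ∈ Finset.range k, T i)) (‖x 0‖ / 2)
  have h3 := le_max_right (2 * β₀ ‖x 0‖ (∑ i ∈ Finset.range k, T i)) (‖x 0‖ / 2)
  linarith
end

section
/- Under the hypotheses and notation of the preceding construction (the modified system x_{k+1} = F̄(x_k, σ(|x_k|)·d_k, T_k) obtained from an S-ISS-VSR system with data (β₀, γ₀, T*), with β = 2β₀, α(s) = β(s,0), σ the K∞ function with γ(σ(s)) = α⁻¹(s)/2, and T^▲(M) := T*(M, γ⁻¹(M/2))), fix M ≥ 0 and for each j ∈ ℕ₀ set M_j := M/2^j, choose t_j ≥ 0 such that β(M_j, t_j) ≤ M_j/2, and set τ_j := j·T^▲(M) + Σ_{i=0}^{j} t_i. Then every solution of the modified system with |x_0| ≤ M, {T_i} ∈ Φ(T^▲(M)) and |d_i| ≤ 1 for all i satisfies |x_k| ≤ M_{j+1} for all j, k ∈ ℕ₀ for which Σ_{i=0}^{k-1} T_i ≥ τ_j. -/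
open scoped BigOperators

theorem statement12 {n q : ℕ}
    (F : EuclideanSpace ℝ (Fin n) → EuclideanSpace ℝ (Fin q) → ℝ → EuclideanSpace ℝ (Fin n))
    (β₀ : ℝ → ℝ → ℝ) (γ₀ : ℝ → ℝ) (hβ₀ : ClassKL β₀) (hγ₀ : ClassKInf γ₀)
    (Ts : ℝ → ℝ → ℝ) (hTs : ∀ M, 0 ≤ M → ∀ Eb, 0 ≤ Eb → 0 < Ts M Eb)
    (hTsmono : ∀ M₁ M₂ E₁ E₂, 0 ≤ M₁ → M₁ ≤ M₂ → 0 ≤ E₁ → E₁ ≤ E₂ → Ts M₂ E₂ ≤ Ts M₁ E₁)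
    (hSISS : ∀ M, 0 ≤ M → ∀ Eb, 0 ≤ Eb →
      ∀ (x : ℕ → EuclideanSpace ℝ (Fin n)) (e : ℕ → EuclideanSpace ℝ (Fin q)) (T : ℕ → ℝ),
        (∀ k, x (k + 1) = F (x k) (e k) (T k)) →
        ‖x 0‖ ≤ M → (∀ i, ‖e i‖ ≤ Eb) → (∀ i, 0 < T i ∧ T i < Ts M Eb) →
        ∀ k, ‖x k‖ ≤ β₀ ‖x 0‖ (∑ i ∈ Finset.range k, T i) +
          γ₀ (⨆ i ∈ Finset.range k, ‖e i‖))
    (αinv γinv σ : ℝ → ℝ)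
    (hαinv : ClassKInf αinv) (hγinv : ClassKInf γinv) (hσ : ClassKInf σ)
    (hαinv' : ∀ s, 0 ≤ s → αinv (2 * β₀ s 0) = s ∧ 2 * β₀ (αinv s) 0 = s)
    (hγinv' : ∀ s, 0 ≤ s → γinv (2 * γ₀ s) = s ∧ 2 * γ₀ (γinv s) = s)
    (hσ' : ∀ s, 0 ≤ s → 2 * γ₀ (σ s) = αinv s / 2)
    (M : ℝ) (hM : 0 ≤ M)
    (t : ℕ → ℝ) (ht0 : ∀ j, 0 ≤ t j)
    (htβ : ∀ j : ℕ, 2 * β₀ (M / 2 ^ j) (t j) ≤ (M / 2 ^ j) / 2) :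
    ∀ (x : ℕ → EuclideanSpace ℝ (Fin n)) (d : ℕ → EuclideanSpace ℝ (Fin q)) (T : ℕ → ℝ),
      (∀ k, x (k + 1) = F (x k) (σ ‖x k‖ • d k) (T k)) →
      ‖x 0‖ ≤ M → (∀ i, ‖d i‖ ≤ 1) → (∀ i, 0 < T i ∧ T i < Ts M (γinv (M / 2))) →
      ∀ (j k : ℕ),
        (j : ℝ) * Ts M (γinv (M / 2)) + (∑ i ∈ Finset.range (j + 1), t i) ≤
          ∑ i ∈ Finset.range k, T i →
        ‖x k‖ ≤ M / 2 ^ (j + 1) := by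
  intro x d T hx hx0 hd hT
  obtain ⟨⟨_, hγm, hγ0⟩, _⟩ := hγ₀
  obtain ⟨⟨_, hgim, hgi0⟩, _⟩ := hγinv
  obtain ⟨⟨_, hσm, hσ0⟩, _⟩ := hσ
  obtain ⟨hβ1, hβ2⟩ := hβ₀
  have hγmono := hγm.monotoneOn
  have hgimono := hgim.monotoneOn
  have hσmono := hσm.monotoneOn
  have hgnn : ∀ s, 0 ≤ s → 0 ≤ γinv s := fun s hs => by
    have := hgimono (Set.mem_Ici.2 le_rfl) (Set.mem_Ici.2 hs) hs
    linarith
  have hσnn : ∀ s, 0 ≤ s → 0 ≤ σ s := fun s hs => by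
    have := hσmono (Set.mem_Ici.2 le_rfl) (Set.mem_Ici.2 hs) hs
    linarith
  have hβmono : ∀ u a b, 0 ≤ u → 0 ≤ a → a ≤ b → β₀ a u ≤ β₀ b u := fun u a b hu ha hab =>
    (hβ1 u hu).2.1.monotoneOn (Set.mem_Ici.2 ha) (Set.mem_Ici.2 (ha.trans hab)) hab
  have hβanti : ∀ m u v, 0 ≤ m → 0 ≤ u → u ≤ v → β₀ m v ≤ β₀ m u := by
    intro m u v hm hu huv
    rcases hm.eq_or_lt with h | h
    · rw [← h, (hβ1 u hu).2.2, (hβ1 v (hu.trans huv)).2.2]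
    · exact (hβ2 m h).1.antitoneOn (Set.mem_Ici.2 hu) (Set.mem_Ici.2 (hu.trans huv)) huv
  -- the case of dimension zero
  rcases Nat.eq_zero_or_pos n with hn | hn
  · subst hn
    intro j k _
    have : x k = 0 := Subsingleton.elim _ _
    rw [this, norm_zero]
    positivity
  -- lower bound on the KL function
  have hβge : ∀ s, 0 ≤ s → s ≤ β₀ s 0 := by
    intro s hs
    let v : EuclideanSpace ℝ (Fin n) := EuclideanSpace.single ⟨0, hn⟩ s
    have hv : ‖v‖ = s := by
      simp [v, abs_of_nonneg hs]
    have hp := hTs s hs 0 le_rfl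
    have := hSISS s hs 0 le_rfl
      (fun i => Nat.rec v (fun _ y => F y 0 (Ts s 0 / 2)) i) (fun _ => 0) (fun _ => Ts s 0 / 2)
      (fun _ => rfl) (le_of_eq hv) (fun _ => by simp) (fun _ => ⟨by linarith, by linarith⟩) 0
    simpa [hv, hγ0] using this
  have hσα : ∀ m, 0 ≤ m → σ (2 * β₀ m 0) = γinv (m / 2) := by
    intro m hm
    have h0 : 0 ≤ 2 * β₀ m 0 := by linarith [hβge m hm]
    have h1 := (hγinv' _ (hσnn _ h0)).1
    rw [hσ' _ h0, (hαinv' m hm).1] at h1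
    exact h1.symm
  have key : ∀ m, 0 ≤ m → m ≤ M →
      ∀ (x : ℕ → EuclideanSpace ℝ (Fin n)) (d : ℕ → EuclideanSpace ℝ (Fin q)) (T : ℕ → ℝ),
      (∀ k, x (k + 1) = F (x k) (σ ‖x k‖ • d k) (T k)) →
      ‖x 0‖ ≤ m → (∀ i, ‖d i‖ ≤ 1) → (∀ i, 0 < T i ∧ T i < Ts M (γinv (M / 2))) →
      ∀ k, ‖x k‖ ≤ β₀ m (∑ i ∈ Finset.range k, T i) + m / 4 ∧ ‖x k‖ ≤ 2 * β₀ m 0 := by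
    intro m hm hmM x d T hx hx0 hd hT k
    induction k using Nat.strong_induction_on with
    | _ k ih =>
    have hg := hgnn (m / 2) (by linarith)
    let e' : ℕ → EuclideanSpace ℝ (Fin q) := fun i => if i < k then σ ‖x i‖ • d i else 0
    have he' : ∀ i, ‖e' i‖ ≤ γinv (m / 2) := by
      intro i
      by_cases hi : i < k
      · simp only [e', hi, if_true]
        rw [norm_smul, Real.norm_of_nonneg (hσnn _ (norm_nonneg _)), ← hσα m hm]
        have h1 := hσmono (Set.mem_Ici.2 (norm_nonneg (x i)))
          (Set.mem_Ici.2 ((norm_nonneg (x i)).trans (ih i hi).2)) (ih i hi).2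
        have h2 := hσnn _ (norm_nonneg (x i))
        nlinarith [hd i]
      · simpa only [e', hi, if_false, norm_zero] using hg
    let x' : ℕ → EuclideanSpace ℝ (Fin n) := fun i => Nat.rec (x 0) (fun i y => F y (e' i) (T i)) i
    have hx' : ∀ i, i ≤ k → x' i = x i := by
      intro i
      induction i with
      | zero => intro _; rfl
      | succ i ihi =>
        intro hi
        have h1 : x' (i + 1) = F (x' i) (e' i) (T i) := rfl
        have h2 : e' i = σ ‖x i‖ • d i := by
          have : i < k := hi
          simp only [e', this, if_true]
        rw [h1, ihi (by omega), h2, hx]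
    have hTm : Ts M (γinv (M / 2)) ≤ Ts m (γinv (m / 2)) :=
      hTsmono _ _ _ _ hm hmM hg (hgimono (Set.mem_Ici.2 (by linarith))
        (Set.mem_Ici.2 (by linarith)) (by linarith))
    have h := hSISS m hm _ hg x' e' T (fun _ => rfl) hx0 he'
      (fun i => ⟨(hT i).1, (hT i).2.trans_le hTm⟩) k
    rw [hx' k le_rfl, hx' 0 (Nat.zero_le _)] at h
    have hs0 : 0 ≤ ⨆ i ∈ Finset.range k, ‖e' i‖ :=
      Real.iSup_nonneg fun i => Real.iSup_nonneg fun _ => norm_nonneg _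
    have hs1 : (⨆ i ∈ Finset.range k, ‖e' i‖) ≤ γinv (m / 2) :=
      Real.iSup_le (fun i => Real.iSup_le (fun _ => he' i) hg) hg
    have h3 := hγmono (Set.mem_Ici.2 hs0) (Set.mem_Ici.2 hg) hs1
    have h4 := (hγinv' (m / 2) (by linarith)).2
    have hS : 0 ≤ ∑ i ∈ Finset.range k, T i := Finset.sum_nonneg fun i _ => (hT i).1.le
    have h5 := hβmono _ _ _ hS (norm_nonneg (x 0)) hx0
    have h6 := hβanti m 0 _ hm le_rfl hS
    have h7 := hβge m hm
    constructor <;> linarith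
  have step : ∀ j : ℕ, ∀ k₀ k : ℕ, ‖x k₀‖ ≤ M / 2 ^ j →
      t j ≤ ∑ i ∈ Finset.range k, T (k₀ + i) → ‖x (k₀ + k)‖ ≤ M / 2 ^ (j + 1) := by
    intro j k₀ k h0 hs
    have hm : 0 ≤ M / 2 ^ j := by positivity
    have hmM : M / 2 ^ j ≤ M := div_le_self hM (one_le_pow₀ (by norm_num))
    have h := (key _ hm hmM (fun i => x (k₀ + i)) (fun i => d (k₀ + i)) (fun i => T (k₀ + i))
      (fun i => hx (k₀ + i)) h0 (fun i => hd _) (fun i => hT _) k).1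
    have h1 := hβanti _ _ _ hm (ht0 j) hs
    have h2 := htβ j
    have h3 : M / 2 ^ (j + 1) = M / 2 ^ j / 2 := by rw [pow_succ, div_div]
    rw [h3]
    linarith
  have hTpos : 0 < Ts M (γinv (M / 2)) := (hT 0).1.trans (hT 0).2
  intro j
  induction j with
  | zero =>
    intro k hk
    have := step 0 0 k (by simpa using hx0) (by simpa using hk)
    simpa using this
  | succ j ih =>
    intro k hk
    rw [Finset.sum_range_succ] at hk
    push_cast at hk
    have hτ : 0 ≤ (j : ℝ) * Ts M (γinv (M / 2)) + ∑ i ∈ Finset.range (j + 1), t i :=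
      add_nonneg (by positivity) (Finset.sum_nonneg fun i _ => ht0 i)
    have hex : ∃ k₀ : ℕ, (j : ℝ) * Ts M (γinv (M / 2)) + (∑ i ∈ Finset.range (j + 1), t i) ≤
        ∑ i ∈ Finset.range k₀, T i := ⟨k, by linarith [ht0 (j + 1)]⟩
    classical
    obtain ⟨k₀, hk₀, hmin⟩ : ∃ k₀ : ℕ, ((j : ℝ) * Ts M (γinv (M / 2)) +
        (∑ i ∈ Finset.range (j + 1), t i) ≤ ∑ i ∈ Finset.range k₀, T i) ∧
        ∀ l < k₀, ¬ ((j : ℝ) * Ts M (γinv (M / 2)) +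
        (∑ i ∈ Finset.range (j + 1), t i) ≤ ∑ i ∈ Finset.range l, T i) :=
      ⟨Nat.find hex, Nat.find_spec hex, fun l hl => Nat.find_min hex hl⟩
    have hle : k₀ ≤ k := by
      by_contra hc
      exact hmin k (by omega) (by linarith [ht0 (j + 1)])
    have hup : ∑ i ∈ Finset.range k₀, T i ≤ (j : ℝ) * Ts M (γinv (M / 2)) +
        (∑ i ∈ Finset.range (j + 1), t i) + Ts M (γinv (M / 2)) := by
      cases k₀ with
      | zero => simp only [Finset.range_zero, Finset.sum_empty]; linarith
      | succ l =>
        have := hmin l (by omega)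
        rw [Finset.sum_range_succ]
        linarith [(hT l).2]
    obtain ⟨r, rfl⟩ := Nat.exists_eq_add_of_le hle
    rw [Finset.sum_range_add T k₀ r] at hk
    exact step (j + 1) k₀ r (ih k₀ hk₀) (by linarith)
end

section
/- Let F̄ : ℝⁿ × ℝ^q × ℝ → ℝⁿ and ρ of class K. Suppose: (i) there exists T̊ > 0 such that F̄(0,0,T) = 0 for all T ∈ (0,T̊); (ii) there exists T̂ > 0 such that for every ε > 0 there exists δ > 0 with |F̄(x,e,T)| < ε whenever |x| ≤ δ, |e| ≤ δ and T ∈ (0,T̂); (iii) there exist C : ℝ≥0 × ℝ≥0 → ℝ>0 nondecreasing in each variable and Ť : ℝ≥0 × ℝ≥0 → ℝ>0 nonincreasing in each variable such that |F̄(x,e,T)| ≤ C(M,E) whenever |x| ≤ M, |e| ≤ E and T ∈ (0,Ť(M,E)). For s ≥ 0 define T̄(s) := min{T̊, T̂, Ť(ρ(s), s)} and σ(s) := sup{ |F̄(x,e,T)| : |x| ≤ ρ(s), |e| ≤ s, T ∈ (0, T̄(s)) }. Then there exists ζ of class K∞ such that σ(s) ≤ ζ(s) for all s ≥ 0. -/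
open scoped BigOperators

theorem aux_majorant (g : ℝ → ℝ) (hg : Monotone g) (h0 : g 0 = 0)
    (hsm : ∀ ε, 0 < ε → ∃ δ, 0 < δ ∧ g δ ≤ ε) :
    ∃ ζ : ℝ → ℝ, ClassKInf ζ ∧ ∀ s, 0 ≤ s → g s ≤ ζ s := by
  have hii : ∀ s, 0 ≤ s → IntervalIntegrable (fun u => g (s * u)) MeasureTheory.volume 1 2 := by
    intro s hs
    apply Monotone.intervalIntegrable
    intro a b hab
    exact hg (mul_le_mul_of_nonneg_left hab hs)
  have hmono : ∀ s t, 0 ≤ s → s ≤ t →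
      (∫ u in (1:ℝ)..2, g (s * u)) ≤ ∫ u in (1:ℝ)..2, g (t * u) := by
    intro s t hs hst
    apply intervalIntegral.integral_mono_on (by norm_num) (hii s hs) (hii t (hs.trans hst))
    intro u hu
    exact hg (mul_le_mul_of_nonneg_right hst (by linarith [hu.1]))
  have hlow : ∀ s, 0 ≤ s → g s ≤ ∫ u in (1:ℝ)..2, g (s * u) := by
    intro s hs
    have h := intervalIntegral.integral_mono_on (μ := MeasureTheory.volume)
      (a := (1:ℝ)) (b := 2) (f := fun _ => g s)
      (by norm_num) (by simp) (hii s hs) (fun u hu => hg (by nlinarith [hu.1]))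
    norm_num at h
    exact h
  have hup : ∀ s, 0 ≤ s → (∫ u in (1:ℝ)..2, g (s * u)) ≤ g (s * 2) := by
    intro s hs
    have h := intervalIntegral.integral_mono_on (μ := MeasureTheory.volume)
      (a := (1:ℝ)) (b := 2) (g := fun _ => g (s * 2))
      (by norm_num) (hii s hs) (by simp) (fun u hu => hg (by nlinarith [hu.2]))
    norm_num at h
    exact h
  have hnn : ∀ s, 0 ≤ s → 0 ≤ g s := fun s hs => h0 ▸ hg hs
  refine ⟨fun s => s + ∫ u in (1:ℝ)..2, g (s * u), ⟨⟨?_, ?_, ?_⟩, ?_⟩, ?_⟩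
  · apply continuousOn_id.add
    intro s hs
    rcases eq_or_lt_of_le (show (0:ℝ) ≤ s from hs) with h | h
    · subst h
      rw [Metric.continuousWithinAt_iff]
      intro ε hε
      obtain ⟨δ, hδ, hgd⟩ := hsm (ε / 2) (by linarith)
      refine ⟨δ / 2, by linarith, ?_⟩
      intro x hx hxd
      have hx' : (0:ℝ) ≤ x := hx
      rw [Real.dist_eq, sub_zero, abs_of_nonneg hx'] at hxd
      have h1 := hlow x hx'
      have h2 := hup x hx'
      have h3 := hnn x hx'
      have h4 : g (x * 2) ≤ g δ := hg (by linarith)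
      simp only [zero_mul, h0, intervalIntegral.integral_zero]
      rw [Real.dist_eq, sub_zero, abs_of_nonneg (by linarith)]
      linarith
    · apply ContinuousAt.continuousWithinAt
      have hprim : Continuous (fun b => ∫ x in (0:ℝ)..b, g x) :=
        intervalIntegral.continuous_primitive (fun a b => hg.intervalIntegrable) 0
      have : ContinuousAt (fun s : ℝ => s⁻¹ * ((∫ x in (0:ℝ)..(s*2), g x) - ∫ x in (0:ℝ)..(s*1), g x)) s := by
        apply (continuousAt_inv₀ h.ne').mul
        apply Continuous.continuousAt
        exact (hprim.comp (by fun_prop : Continuous fun s : ℝ => s * 2)).sub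
          (hprim.comp (by fun_prop : Continuous fun s : ℝ => s * 1))
      apply this.congr
      filter_upwards [lt_mem_nhds h] with t ht
      rw [intervalIntegral.integral_comp_mul_left g ht.ne', smul_eq_mul,
        intervalIntegral.integral_interval_sub_left hg.intervalIntegrable hg.intervalIntegrable]
  · intro a ha b hb hab
    exact add_lt_add_of_lt_of_le hab (hmono a b ha hab.le)
  · simp [h0]
  · apply Filter.tendsto_atTop_mono' _ _ Filter.tendsto_id
    filter_upwards [Filter.eventually_ge_atTop (0:ℝ)] with s hs
    have := hlow s hs
    have := hnn s hs
    simp only [id]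
    linarith
  · intro s hs
    have := hlow s hs
    show g s ≤ s + _
    linarith

theorem statement13 {n q : ℕ}
    (F : EuclideanSpace ℝ (Fin n) → EuclideanSpace ℝ (Fin q) → ℝ → EuclideanSpace ℝ (Fin n))
    (ρ : ℝ → ℝ) (hρ : ClassK ρ)
    (Tr : ℝ) (hTr : 0 < Tr) (hzero : ∀ T : ℝ, 0 < T → T < Tr → F 0 0 T = 0)
    (Th : ℝ) (hTh : 0 < Th)
    (hcont : ∀ ε, 0 < ε → ∃ δ, 0 < δ ∧
      ∀ (x : EuclideanSpace ℝ (Fin n)) (e : EuclideanSpace ℝ (Fin q)) (T : ℝ),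
        ‖x‖ ≤ δ → ‖e‖ ≤ δ → 0 < T → T < Th → ‖F x e T‖ < ε)
    (C Tc : ℝ → ℝ → ℝ)
    (hCpos : ∀ M, 0 ≤ M → ∀ Eb, 0 ≤ Eb → 0 < C M Eb)
    (hCmono : ∀ M₁ M₂ E₁ E₂, 0 ≤ M₁ → M₁ ≤ M₂ → 0 ≤ E₁ → E₁ ≤ E₂ → C M₁ E₁ ≤ C M₂ E₂)
    (hTcpos : ∀ M, 0 ≤ M → ∀ Eb, 0 ≤ Eb → 0 < Tc M Eb)
    (hTcmono : ∀ M₁ M₂ E₁ E₂, 0 ≤ M₁ → M₁ ≤ M₂ → 0 ≤ E₁ → E₁ ≤ E₂ → Tc M₂ E₂ ≤ Tc M₁ E₁)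
    (hbound : ∀ M, 0 ≤ M → ∀ Eb, 0 ≤ Eb →
      ∀ (x : EuclideanSpace ℝ (Fin n)) (e : EuclideanSpace ℝ (Fin q)) (T : ℝ),
        ‖x‖ ≤ M → ‖e‖ ≤ Eb → 0 < T → T < Tc M Eb → ‖F x e T‖ ≤ C M Eb) :
    ∃ ζ : ℝ → ℝ, ClassKInf ζ ∧ ∀ s, 0 ≤ s →
      sSup {r : ℝ | ∃ (x : EuclideanSpace ℝ (Fin n)) (e : EuclideanSpace ℝ (Fin q)) (T : ℝ),
        ‖x‖ ≤ ρ s ∧ ‖e‖ ≤ s ∧ 0 < T ∧ T < min Tr (min Th (Tc (ρ s) s)) ∧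
        r = ‖F x e T‖} ≤ ζ s := by
  classical
  obtain ⟨hρc, hρm, hρ0⟩ := hρ
  have hρnn : ∀ s, 0 ≤ s → 0 ≤ ρ s := fun s hs => hρ0 ▸ hρm.monotoneOn Set.self_mem_Ici hs hs
  let S : ℝ → Set ℝ := fun s => insert 0 {r : ℝ | ∃ (s' : ℝ) (x : EuclideanSpace ℝ (Fin n))
    (e : EuclideanSpace ℝ (Fin q)) (T : ℝ), 0 ≤ s' ∧ s' ≤ s ∧
        ‖x‖ ≤ ρ s' ∧ ‖e‖ ≤ s' ∧ 0 < T ∧ T < min Tr (min Th (Tc (ρ s') s')) ∧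
        r = ‖F x e T‖}
  have hne : ∀ s, (S s).Nonempty := fun s => ⟨0, Set.mem_insert _ _⟩
  have hbdd : ∀ s, BddAbove (S s) := by
    intro s
    refine ⟨max 0 (C (ρ s) s), ?_⟩
    rintro r (rfl | ⟨s', x, e, T, h0, h1, hx, he, hT, hT2, rfl⟩)
    · exact le_max_left _ _
    · refine le_trans ?_ (le_max_right _ _)
      simp only [lt_min_iff] at hT2
      exact (hbound _ (hρnn s' h0) _ h0 x e T hx he hT hT2.2.2).trans
        (hCmono _ _ _ _ (hρnn s' h0) (hρm.monotoneOn h0 (h0.trans h1) h1) h0 h1)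
  have key := aux_majorant (fun s => sSup (S s))
  suffices hh : Monotone (fun s => sSup (S s)) ∧ sSup (S 0) = 0 ∧
      ∀ ε, 0 < ε → ∃ δ, 0 < δ ∧ sSup (S δ) ≤ ε by
    obtain ⟨ζ, hζ, hle⟩ := key hh.1 hh.2.1 hh.2.2
    refine ⟨ζ, hζ, fun s hs => le_trans ?_ (hle s hs)⟩
    apply Real.sSup_le
    · rintro r ⟨x, e, T, hx, he, hT, hT2, rfl⟩
      exact le_csSup (hbdd s) (Or.inr ⟨s, x, e, T, hs, le_rfl, hx, he, hT, hT2, rfl⟩)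
    · exact le_csSup (hbdd s) (Set.mem_insert _ _)
  refine ⟨?_, ?_, ?_⟩
  · intro a b hab
    apply csSup_le_csSup (hbdd b) (hne a)
    rintro r (rfl | ⟨s', x, e, T, h0, h1, h⟩)
    · exact Set.mem_insert _ _
    · exact Or.inr ⟨s', x, e, T, h0, h1.trans hab, h⟩
  · apply le_antisymm
    · apply csSup_le (hne 0)
      rintro r (rfl | ⟨s', x, e, T, h0, h1, hx, he, hT, hT2, rfl⟩)
      · exact le_rfl
      · have : s' = 0 := le_antisymm h1 h0
        subst this
        rw [hρ0] at hx
        have hx0 : x = 0 := norm_le_zero_iff.mp hx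
        have he0 : e = 0 := norm_le_zero_iff.mp he
        simp only [lt_min_iff] at hT2
        rw [hx0, he0, hzero T hT hT2.1, norm_zero]
    · exact le_csSup (hbdd 0) (Set.mem_insert _ _)
  · intro ε hε
    obtain ⟨δ, hδ, hF⟩ := hcont ε hε
    have hc := hρc 0 Set.self_mem_Ici
    rw [Metric.continuousWithinAt_iff] at hc
    obtain ⟨η, hη, hρη⟩ := hc δ hδ
    refine ⟨min δ (η / 2), lt_min hδ (by linarith), ?_⟩
    apply csSup_le (hne _)
    rintro r (rfl | ⟨s', x, e, T, h0, h1, hx, he, hT, hT2, rfl⟩)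
    · exact hε.le
    · simp only [lt_min_iff] at hT2
      have h2 := h1.trans (min_le_left _ _)
      have h3 := h1.trans (min_le_right _ _)
      have h4 := hρη (x := s') h0 (by rw [Real.dist_eq, sub_zero, abs_of_nonneg h0]; linarith)
      rw [Real.dist_eq, hρ0, sub_zero] at h4
      exact (hF x e T (hx.trans ((le_abs_self _).trans h4.le)) (he.trans h2) hT hT2.2.1).le
end

section
/- Let F̄ : ℝⁿ × ℝ^q × ℝ → ℝⁿ, let α₁, α₂ be of class K∞ with α₁(s) ≤ α₂(s) for all s ≥ 0, let ρ be of class K and η of class K∞ with ρ(s) ≤ η(s) for all s ≥ 0, let M₀, E₀ ≥ 0 and T* > 0, and set M := α₁⁻¹(α₂(max{M₀, η(E₀)})). Suppose V : ℝⁿ → ℝ≥0 ∪ {∞} satisfies α₁(|x|) ≤ V(x) for all x ∈ ℝⁿ and V(x) ≤ α₂(|x|) for all |x| ≤ M; that V(F̄(x,e,T)) ≤ V(x) whenever ρ(|e|) ≤ |x| ≤ M, |e| ≤ E₀ and T ∈ (0,T*); and that |F̄(x,e,T)| ≤ η(|e|) whenever |x| ≤ ρ(|e|), |e| ≤ E₀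 and T ∈ (0,T*). Then every solution of x_{k+1} = F̄(x_k, e_k, T_k) with |x_0| ≤ M₀, |e_i| ≤ E₀ for all i, and T_i ∈ (0,T*) for all i, satisfies |x_k| ≤ M for all k ∈ ℕ₀. -/
open scoped BigOperators

theorem statement14 {n q : ℕ}
    (F : EuclideanSpace ℝ (Fin n) → EuclideanSpace ℝ (Fin q) → ℝ → EuclideanSpace ℝ (Fin n))
    (α₁ α₂ : ℝ → ℝ) (hα₁ : ClassKInf α₁) (hα₂ : ClassKInf α₂)
    (hα₁₂ : ∀ s, 0 ≤ s → α₁ s ≤ α₂ s)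
    (α₁inv : ℝ → ℝ) (hα₁inv : ClassKInf α₁inv)
    (hα₁inv' : ∀ s, 0 ≤ s → α₁inv (α₁ s) = s ∧ α₁ (α₁inv s) = s)
    (ρ η : ℝ → ℝ) (hρ : ClassK ρ) (hη : ClassKInf η)
    (hρη : ∀ s, 0 ≤ s → ρ s ≤ η s)
    (M₀ E₀ : ℝ) (hM₀ : 0 ≤ M₀) (hE₀ : 0 ≤ E₀)
    (Tst : ℝ) (hTst : 0 < Tst)
    (M : ℝ) (hM : M = α₁inv (α₂ (max M₀ (η E₀))))
    (V : EuclideanSpace ℝ (Fin n) → ENNReal)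
    (hV₁ : ∀ x : EuclideanSpace ℝ (Fin n), ENNReal.ofReal (α₁ ‖x‖) ≤ V x)
    (hV₂ : ∀ x : EuclideanSpace ℝ (Fin n), ‖x‖ ≤ M → V x ≤ ENNReal.ofReal (α₂ ‖x‖))
    (hVdec : ∀ (x : EuclideanSpace ℝ (Fin n)) (e : EuclideanSpace ℝ (Fin q)) (T : ℝ),
      ρ ‖e‖ ≤ ‖x‖ → ‖x‖ ≤ M → ‖e‖ ≤ E₀ → 0 < T → T < Tst → V (F x e T) ≤ V x)
    (hFη : ∀ (x : EuclideanSpace ℝ (Fin n)) (e : EuclideanSpace ℝ (Fin q)) (T : ℝ),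
      ‖x‖ ≤ ρ ‖e‖ → ‖e‖ ≤ E₀ → 0 < T → T < Tst → ‖F x e T‖ ≤ η ‖e‖) :
    ∀ (x : ℕ → EuclideanSpace ℝ (Fin n)) (e : ℕ → EuclideanSpace ℝ (Fin q)) (T : ℕ → ℝ),
      (∀ k, x (k + 1) = F (x k) (e k) (T k)) →
      ‖x 0‖ ≤ M₀ → (∀ i, ‖e i‖ ≤ E₀) → (∀ i, 0 < T i ∧ T i < Tst) →
      ∀ k, ‖x k‖ ≤ M := by
  intro x e T hx hx0 he hT
  obtain ⟨⟨-, m1, z1⟩, -⟩ := hα₁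
  obtain ⟨⟨-, m2, z2⟩, -⟩ := hα₂
  obtain ⟨⟨-, mi, zi⟩, -⟩ := hα₁inv
  obtain ⟨⟨-, mη, zη⟩, -⟩ := hη
  set m := max M₀ (η E₀) with hm
  have m0 : 0 ≤ m := le_max_of_le_left hM₀
  have a0 : 0 ≤ α₂ m := by
    rw [← z2]; exact m2.monotoneOn (Set.mem_Ici.2 le_rfl) m0 m0
  have M0 : 0 ≤ M := by
    rw [hM, ← zi]; exact mi.monotoneOn (Set.mem_Ici.2 le_rfl) a0 a0
  have hαM : α₁ M = α₂ m := by rw [hM]; exact (hα₁inv' _ a0).2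
  have hmM : m ≤ M := by
    rw [← m1.le_iff_le m0 M0, hαM]; exact hα₁₂ m m0
  have key : ∀ y, ‖y‖ ≤ m → V y ≤ ENNReal.ofReal (α₂ m) := fun y hy =>
    (hV₂ y (hy.trans hmM)).trans
      (ENNReal.ofReal_le_ofReal (m2.monotoneOn (norm_nonneg y) m0 hy))
  have key2 : ∀ y, V y ≤ ENNReal.ofReal (α₂ m) → ‖y‖ ≤ M := fun y hy => by
    rw [← m1.le_iff_le (norm_nonneg y) M0, hαM]
    exact (ENNReal.ofReal_le_ofReal_iff a0).1 ((hV₁ y).trans hy)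
  have main : ∀ k, V (x k) ≤ ENNReal.ofReal (α₂ m) := by
    intro k
    induction k with
    | zero => exact key _ (hx0.trans (le_max_left _ _))
    | succ k ih =>
      rw [hx k]
      rcases le_total (ρ ‖e k‖) ‖x k‖ with h | h
      · exact (hVdec _ _ _ h (key2 _ ih) (he k) (hT k).1 (hT k).2).trans ih
      · exact key _ ((hFη _ _ _ h (he k) (hT k).1 (hT k).2).trans
          ((mη.monotoneOn (norm_nonneg _) hE₀ (he k)).trans (le_max_right _ _)))
  exact fun k => key2 _ (main k)
end

section
/- Let F̄ : ℝⁿ × ℝ^q × ℝ → ℝⁿ, let α₁, α₂ be of class K∞ with α₁(s) ≤ α₂(s) for all s ≥ 0, let ρ be of class K and η of class K∞ with ρ(s) ≤ η(s) for all s ≥ 0, let E₀ ≥ 0 and T* > 0, and let {e_i} ⊂ ℝ^q be a sequence with s̄ := sup_i |e_i| ≤ E₀. Set M ≥ α₁⁻¹(α₂(η(E₀))) and define the sublevel set 𝒳₂ := {x ∈ ℝⁿ : V(x) ≤ α₂(η(s̄))}. Suppose V : ℝⁿ → ℝ≥0 ∪ {∞} satisfies α₁(|x|) ≤ V(x) for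 all x ∈ ℝⁿ and V(x) ≤ α₂(|x|) for all |x| ≤ M; that V(F̄(x,e,T)) ≤ V(x) whenever ρ(|e|) ≤ |x| ≤ M, |e| ≤ E₀ and T ∈ (0,T*); and that |F̄(x,e,T)| ≤ η(|e|) whenever |x| ≤ ρ(|e|), |e| ≤ E₀ and T ∈ (0,T*). Then 𝒳₂ is forward invariant along solutions: if a solution of x_{k+1} = F̄(x_k, e_k, T_k) with T_i ∈ (0,T*) for all i satisfies x_ℓ ∈ 𝒳₂ for some ℓ ∈ ℕ₀, then x_k ∈ 𝒳₂ for all k ≥ ℓ. -/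
open scoped BigOperators

theorem statement15 {n q : ℕ}
    (F : EuclideanSpace ℝ (Fin n) → EuclideanSpace ℝ (Fin q) → ℝ → EuclideanSpace ℝ (Fin n))
    (α₁ α₂ : ℝ → ℝ) (hα₁ : ClassKInf α₁) (hα₂ : ClassKInf α₂)
    (hα₁₂ : ∀ s, 0 ≤ s → α₁ s ≤ α₂ s)
    (α₁inv : ℝ → ℝ) (hα₁inv : ClassKInf α₁inv)
    (hα₁inv' : ∀ s, 0 ≤ s → α₁inv (α₁ s) = s ∧ α₁ (α₁inv s) = s)
    (ρ η : ℝ → ℝ) (hρ : ClassK ρ) (hη : ClassKInf η)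
    (hρη : ∀ s, 0 ≤ s → ρ s ≤ η s)
    (E₀ : ℝ) (hE₀ : 0 ≤ E₀)
    (Tst : ℝ) (hTst : 0 < Tst)
    (e : ℕ → EuclideanSpace ℝ (Fin q)) (hebd : ∀ i, ‖e i‖ ≤ E₀)
    (M : ℝ) (hM : α₁inv (α₂ (η E₀)) ≤ M)
    (V : EuclideanSpace ℝ (Fin n) → ENNReal)
    (hV₁ : ∀ x : EuclideanSpace ℝ (Fin n), ENNReal.ofReal (α₁ ‖x‖) ≤ V x)
    (hV₂ : ∀ x : EuclideanSpace ℝ (Fin n), ‖x‖ ≤ M → V x ≤ ENNReal.ofReal (α₂ ‖x‖))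
    (hVdec : ∀ (x : EuclideanSpace ℝ (Fin n)) (e' : EuclideanSpace ℝ (Fin q)) (T : ℝ),
      ρ ‖e'‖ ≤ ‖x‖ → ‖x‖ ≤ M → ‖e'‖ ≤ E₀ → 0 < T → T < Tst → V (F x e' T) ≤ V x)
    (hFη : ∀ (x : EuclideanSpace ℝ (Fin n)) (e' : EuclideanSpace ℝ (Fin q)) (T : ℝ),
      ‖x‖ ≤ ρ ‖e'‖ → ‖e'‖ ≤ E₀ → 0 < T → T < Tst → ‖F x e' T‖ ≤ η ‖e'‖) :
    ∀ (x : ℕ → EuclideanSpace ℝ (Fin n)) (T : ℕ → ℝ),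
      (∀ k, x (k + 1) = F (x k) (e k) (T k)) →
      (∀ i, 0 < T i ∧ T i < Tst) →
      ∀ ℓ : ℕ, V (x ℓ) ≤ ENNReal.ofReal (α₂ (η (⨆ i, ‖e i‖))) →
        ∀ k, ℓ ≤ k → V (x k) ≤ ENNReal.ofReal (α₂ (η (⨆ i, ‖e i‖))) := by
  intro x T hx hT ℓ hℓ
  have nn : ∀ {f : ℝ → ℝ}, ClassK f → ∀ a, 0 ≤ a → 0 ≤ f a := by
    intro f hf a ha
    have h := hf.2.1.monotoneOn (Set.mem_Ici.2 le_rfl) (Set.mem_Ici.2 ha) ha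
    rwa [hf.2.2] at h
  have mono : ∀ {f : ℝ → ℝ}, ClassK f → ∀ a b, 0 ≤ a → a ≤ b → f a ≤ f b := by
    intro f hf a b ha hab
    exact hf.2.1.monotoneOn (Set.mem_Ici.2 ha) (Set.mem_Ici.2 (ha.trans hab)) hab
  have hbdd : BddAbove (Set.range fun i => ‖e i‖) := ⟨E₀, by rintro _ ⟨i, rfl⟩; exact hebd i⟩
  have hle : ∀ i, ‖e i‖ ≤ ⨆ i, ‖e i‖ := fun i => le_ciSup hbdd i
  have hsE : (⨆ i, ‖e i‖) ≤ E₀ := ciSup_le hebd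
  have hs0 : 0 ≤ ⨆ i, ‖e i‖ := (norm_nonneg _).trans (hle 0)
  generalize (⨆ i, ‖e i‖) = s at *
  have hηs := nn hη.1 s hs0
  have hηE := mono hη.1 s E₀ hs0 hsE
  have hαE := mono hα₂.1 _ _ hηs hηE
  have hηE0 := nn hη.1 E₀ hE₀
  have hηM : η E₀ ≤ M := by
    have h := mono hα₁inv.1 _ _ (nn hα₁.1 _ hηE0) (hα₁₂ _ hηE0)
    rw [(hα₁inv' _ hηE0).1] at h
    exact h.trans hM
  intro k hk
  induction k, hk using Nat.le_induction with
  | base => exact hℓ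
  | succ k hk ih =>
    rw [hx k]
    have hα0 := nn hα₂.1 _ hηs
    have h1 : α₁ ‖x k‖ ≤ α₂ (η s) :=
      (ENNReal.ofReal_le_ofReal_iff hα0).1 ((hV₁ (x k)).trans ih)
    have h2 := mono hα₁inv.1 _ _ (nn hα₁.1 _ (norm_nonneg (x k))) (h1.trans hαE)
    rw [(hα₁inv' _ (norm_nonneg _)).1] at h2
    rcases le_total (ρ ‖e k‖) ‖x k‖ with h | h
    · exact (hVdec _ _ _ h (h2.trans hM) (hebd k) (hT k).1 (hT k).2).trans ih
    · have h3 := (hFη _ _ _ h (hebd k) (hT k).1 (hT k).2).trans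
        (mono hη.1 _ _ (norm_nonneg _) (hle k))
      exact (hV₂ _ (h3.trans (hηE.trans hηM))).trans
        (ENNReal.ofReal_le_ofReal (mono hα₂.1 _ _ (norm_nonneg _) h3))
end

section
/- Let F̄ : ℝ × ℝ × ℝ → ℝ be defined by F̄(x,e,T) = x − T·(2x³ + 9ex² + (9e² + 1)x + 3e³ + e). Let K = 1/40 and set a := 9K⁶ + 135K⁴ + 174K³ + 117K² + 90K + 4, b := 6K⁴ + 24K³ + 36K² + 22K + 4, c := K² + 2K + 1. Then for every M ≥ 0, with T̃ := min{ 1/(2b), 1/(2(aM⁴ + c)) }, the inequality (F̄(x,e,T))² − x² ≤ −T·(3x⁴ + x²) holds for all x, e, T ∈ ℝ with |e| ≤ K·|x|, |x| ≤ M and 0 < T < T̃. -/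
theorem statement17 (K a b c : ℝ)
    (hK : K = 1 / 40)
    (ha : a = 9 * K ^ 6 + 135 * K ^ 4 + 174 * K ^ 3 + 117 * K ^ 2 + 90 * K + 4)
    (hb : b = 6 * K ^ 4 + 24 * K ^ 3 + 36 * K ^ 2 + 22 * K + 4)
    (hc : c = K ^ 2 + 2 * K + 1) :
    ∀ M : ℝ, 0 ≤ M →
      ∀ x e T : ℝ, |e| ≤ K * |x| → |x| ≤ M → 0 < T →
        T < min (1 / (2 * b)) (1 / (2 * (a * M ^ 4 + c))) →
        (x - T * (2 * x ^ 3 + 9 * e * x ^ 2 + (9 * e ^ 2 + 1) * x + 3 * e ^ 3 + e)) ^ 2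
            - x ^ 2 ≤ -T * (3 * x ^ 4 + x ^ 2) := by
  intro M hM x e T he hx hT hTm
  obtain ⟨h1, h2⟩ := lt_min_iff.mp hTm
  have ha0 : 0 < a := by rw [ha, hK]; norm_num
  have hb0 : 0 < b := by rw [hb, hK]; norm_num
  have hc0 : 0 < c := by rw [hc, hK]; norm_num
  have h1' : T * (2 * b) < 1 := (lt_div_iff₀ (by positivity)).mp h1
  have h2' : T * (2 * (a * M ^ 4 + c)) < 1 := (lt_div_iff₀ (by positivity)).mp h2
  by_cases hx0 : x = 0
  · subst hx0
    have : e = 0 := by simpa using he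
    subst this
    simp
  obtain ⟨s, rfl⟩ : ∃ s, e = s * x := ⟨e / x, by field_simp⟩
  have hs : |s| ≤ K := by
    rw [abs_mul] at he
    exact le_of_mul_le_mul_right he (abs_pos.mpr hx0)
  rw [hK] at hs
  obtain ⟨hs1, hs2⟩ := abs_le.mp hs
  obtain ⟨p, hp⟩ : ∃ p, p = 2 + 9 * s + 9 * s ^ 2 + 3 * s ^ 3 := ⟨_, rfl⟩
  obtain ⟨y, hy⟩ : ∃ y, y = x ^ 2 := ⟨_, rfl⟩
  have hy0 : 0 ≤ y := by rw [hy]; positivity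
  have hyM : y ^ 2 ≤ M ^ 4 := by
    have : |x| ^ 4 ≤ M ^ 4 := by gcongr
    calc y ^ 2 = |x| ^ 4 := by rw [hy, ← sq_abs x]; ring
      _ ≤ _ := this
  have hss : s ^ 2 ≤ 1 / 1600 := by nlinarith
  have hs3 : s ^ 3 ≤ 1 / 64000 := by nlinarith [sq_nonneg s]
  have hs3' : -(1 / 64000) ≤ s ^ 3 := by nlinarith [sq_nonneg s]
  have hpl : 1.77 ≤ p := by rw [hp]; nlinarith [sq_nonneg s]
  have hpu : p ≤ 2 + 9 / 40 + 9 / 1600 + 3 / 64000 := by rw [hp]; linarith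
  have hpa : p ^ 2 ≤ a := by
    have : p ^ 2 ≤ (2 + 9 / 40 + 9 / 1600 + 3 / 64000) ^ 2 := by gcongr
    refine this.trans ?_
    rw [ha, hK]; norm_num
  have hpb : 2 * p * (1 + s) ≤ b := by
    have : 2 * p * (1 + s) ≤ 2 * (2 + 9 / 40 + 9 / 1600 + 3 / 64000) * (1 + 1 / 40) := by
      gcongr
      linarith
    refine this.trans ?_
    rw [hb, hK]; norm_num
  have hqc : (1 + s) ^ 2 ≤ c := by
    rw [hc, hK]; nlinarith
  have key : T * (p * y + (1 + s)) ^ 2 ≤ (2 * p - 3) * y + (2 * (1 + s) - 1) := by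
    have e1 : p ^ 2 * y ^ 2 ≤ a * M ^ 4 := by gcongr
    have e2 : 2 * p * (1 + s) * y ≤ b * y := by gcongr
    have e3 : (p * y + (1 + s)) ^ 2 ≤ (a * M ^ 4 + c) + b * y := by nlinarith
    have e4 := mul_le_mul_of_nonneg_left e3 hT.le
    have e5 : T * b * y ≤ 1 / 2 * y := by
      gcongr; linarith
    have e6 : (1 / 2) * y ≤ (2 * p - 3) * y := by
      gcongr; linarith
    linarith
  have hTy : 0 ≤ T * y := by positivity
  have := mul_le_mul_of_nonneg_left key hTy
  subst hp hy
  linarith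
end

section
/- The scalar discrete-time system x_{k+1} = x_k − T_k·(2x_k³ + 9e_k x_k² + (9e_k² + 1)x_k + 3e_k³ + e_k), with state x_k ∈ ℝ, input (state-measurement error) e_k ∈ ℝ and sampling periods T_k > 0, is S-ISS-VSR. -/
open scoped BigOperators

lemma step_pos (x e T R E : ℝ) (hT : 0 < T) (hC : T * (10 * R ^ 2 + 2000 * E ^ 2 + 9) ≤ 1)
    (hx0 : 0 ≤ x) (hx : x ≤ R) (h1 : -x ≤ 8 * e) (h2 : 8 * e ≤ x) :
    |x - T * (2 * x ^ 3 + 9 * e * x ^ 2 + (9 * e ^ 2 + 1) * x + 3 * e ^ 3 + e)|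
      ≤ (1 - T / 2) * x := by
  have he2 : 64 * e ^ 2 ≤ x ^ 2 := by nlinarith
  have a1 : -x ^ 3 ≤ 8 * (e * x ^ 2) := by nlinarith [mul_nonneg (sq_nonneg x) (by linarith : 0 ≤ 8 * e + x)]
  have a2 : 8 * (e * x ^ 2) ≤ x ^ 3 := by nlinarith [mul_nonneg (sq_nonneg x) (by linarith : 0 ≤ x - 8 * e)]
  have b0 : 0 ≤ e ^ 2 * x := by positivity
  have b1 : 64 * (e ^ 2 * x) ≤ x ^ 3 := by nlinarith
  have c1 : -(e ^ 2 * x) ≤ 8 * e ^ 3 := by nlinarith [mul_nonneg (sq_nonneg e) (by linarith : 0 ≤ 8 * e + x)]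
  have c2 : 8 * e ^ 3 ≤ e ^ 2 * x := by nlinarith [mul_nonneg (sq_nonneg e) (by linarith : 0 ≤ x - 8 * e)]
  have d : 0 ≤ x ^ 3 := by positivity
  have hR : x ^ 3 ≤ R ^ 2 * x := by
    have : x ^ 2 ≤ R ^ 2 := by gcongr
    nlinarith
  set f := 2 * x ^ 3 + 9 * e * x ^ 2 + (9 * e ^ 2 + 1) * x + 3 * e ^ 3 + e with hf
  have l : x / 2 ≤ f := by rw [hf]; nlinarith
  have u : f ≤ x * (10 * R ^ 2 + 2000 * E ^ 2 + 9) := by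
    have : 0 ≤ x * E ^ 2 := by positivity
    rw [hf]; nlinarith
  have v : T * f ≤ x := by
    calc T * f ≤ T * (x * (10 * R ^ 2 + 2000 * E ^ 2 + 9)) := by gcongr
      _ = x * (T * (10 * R ^ 2 + 2000 * E ^ 2 + 9)) := by ring
      _ ≤ x * 1 := by gcongr
      _ = x := by ring
  rw [abs_of_nonneg (by linarith)]
  nlinarith

lemma step (x e T R E : ℝ) (hT : 0 < T) (hC : T * (10 * R ^ 2 + 2000 * E ^ 2 + 9) ≤ 1)
    (hx : |x| ≤ R) (he : |e| ≤ E) :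
    |x - T * (2 * x ^ 3 + 9 * e * x ^ 2 + (9 * e ^ 2 + 1) * x + 3 * e ^ 3 + e)|
      ≤ (1 - T / 2) * |x| ∨
    |x - T * (2 * x ^ 3 + 9 * e * x ^ 2 + (9 * e ^ 2 + 1) * x + 3 * e ^ 3 + e)| ≤ 9 * |e| := by
  by_cases h : 8 * |e| ≤ |x|
  · left
    have p := neg_abs_le e
    have q := le_abs_self e
    rcases le_total 0 x with h0 | h0
    · rw [abs_of_nonneg h0] at *
      exact step_pos x e T R E hT hC h0 hx (by linarith) (by linarith)
    · rw [abs_of_nonpos h0] at *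
      have := step_pos (-x) (-e) T R E hT hC (by linarith) hx (by linarith) (by linarith)
      rw [← abs_neg]
      convert this using 2
      ring
  · right
    push Not at h
    have hx' : |x| ≤ 8 * |e| := h.le
    set a := |e| with ha
    have ha0 : 0 ≤ a := abs_nonneg e
    have hb0 : 0 ≤ |x| := abs_nonneg x
    have hf : |2 * x ^ 3 + 9 * e * x ^ 2 + (9 * e ^ 2 + 1) * x + 3 * e ^ 3 + e|
        ≤ a * (10 * R ^ 2 + 2000 * E ^ 2 + 9) := by
      calc _ ≤ |2 * x ^ 3| + |9 * e * x ^ 2| + |(9 * e ^ 2 + 1) * x| + |3 * e ^ 3| + |e| := by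
            refine (abs_add_le _ _).trans ?_
            gcongr
            refine (abs_add_le _ _).trans ?_
            gcongr
            refine (abs_add_le _ _).trans ?_
            gcongr
            exact abs_add_le _ _
        _ = 2 * |x| ^ 3 + 9 * a * |x| ^ 2 + (9 * a ^ 2 + 1) * |x| + 3 * a ^ 3 + a := by
            have : |9 * e ^ 2 + 1| = 9 * e ^ 2 + 1 := abs_of_nonneg (by positivity)
            rw [abs_mul _ x, this]
            simp only [abs_mul, abs_pow, ha, sq_abs]
            norm_num
        _ ≤ 2 * (8 * a) ^ 3 + 9 * a * (8 * a) ^ 2 + (9 * a ^ 2 + 1) * (8 * a) + 3 * a ^ 3 + a := by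
            gcongr
        _ = a * (1675 * a ^ 2 + 9) := by ring
        _ ≤ a * (10 * R ^ 2 + 2000 * E ^ 2 + 9) := by
            have : a ^ 2 ≤ E ^ 2 := by gcongr
            gcongr
            nlinarith [sq_nonneg R, sq_nonneg E]
    refine (abs_sub _ _).trans ?_
    rw [abs_mul, abs_of_pos hT]
    have : T * |2 * x ^ 3 + 9 * e * x ^ 2 + (9 * e ^ 2 + 1) * x + 3 * e ^ 3 + e| ≤ a := by
      calc _ ≤ T * (a * (10 * R ^ 2 + 2000 * E ^ 2 + 9)) := by gcongr
        _ = a * (T * (10 * R ^ 2 + 2000 * E ^ 2 + 9)) := by ring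
        _ ≤ a * 1 := by gcongr
        _ = a := by ring
    linarith

theorem statement18 :
    SISSVSR (fun x e T : ℝ =>
      x - T * (2 * x ^ 3 + 9 * e * x ^ 2 + (9 * e ^ 2 + 1) * x + 3 * e ^ 3 + e)) := by
  refine ⟨fun s t => s * Real.exp (-(t / 2)), fun s => 9 * s, ⟨?_, ?_⟩, ⟨⟨?_, ?_, ?_⟩, ?_⟩, ?_⟩
  · intro t _
    refine ⟨by fun_prop, ?_, by simp⟩
    intro a _ b _ hab
    exact mul_lt_mul_of_pos_right hab (Real.exp_pos _)
  · intro s hs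
    refine ⟨?_, ?_⟩
    · intro a _ b _ hab
      refine mul_lt_mul_of_pos_left (Real.exp_lt_exp.2 ?_) hs
      linarith
    · have : Filter.Tendsto (fun t : ℝ => Real.exp (-(t / 2))) Filter.atTop (nhds 0) :=
        Real.tendsto_exp_neg_atTop_nhds_zero.comp
          (Filter.tendsto_id.atTop_div_const (by norm_num))
      simpa using this.const_mul s
  · fun_prop
  · intro a _ b _ hab
    show 9 * a < 9 * b
    linarith
  · simp
  · exact Filter.tendsto_id.const_mul_atTop (by norm_num)
  intro M hM E hE
  set R := max M (9 * E) with hR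
  have hCpos : 0 < 10 * R ^ 2 + 2000 * E ^ 2 + 9 := by positivity
  refine ⟨1 / (10 * R ^ 2 + 2000 * E ^ 2 + 9), by positivity, ?_⟩
  intro x e T hdyn hx0 he hT k
  simp only [Real.norm_eq_abs] at *
  have key : ∀ D, 0 ≤ D → D ≤ E → ∀ j, (∀ i < j, |e i| ≤ D) →
      |x j| ≤ max (|x 0| * Real.exp (-((∑ i ∈ Finset.range j, T i) / 2))) (9 * D) := by
    intro D hD hDE j
    induction j with
    | zero => intro _; simp
    | succ j ih =>
      intro hj
      have ih := ih (fun i hi => hj i (by omega))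
      have hS : 0 ≤ ∑ i ∈ Finset.range j, T i := Finset.sum_nonneg fun i _ => (hT i).1.le
      have hxR : |x j| ≤ R := by
        refine ih.trans (max_le_max ?_ (by linarith))
        have : Real.exp (-((∑ i ∈ Finset.range j, T i) / 2)) ≤ 1 :=
          Real.exp_le_one_iff.2 (by linarith)
        nlinarith [abs_nonneg (x 0)]
      have hTC : T j * (10 * R ^ 2 + 2000 * E ^ 2 + 9) ≤ 1 :=
        ((lt_div_iff₀ hCpos).1 (hT j).2).le
      have hTj := (hT j).1
      rw [hdyn j]
      rcases step (x j) (e j) (T j) R E hTj hTC hxR (he j) with h | h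
      · refine h.trans ?_
        have hT1 : T j ≤ 1 := by nlinarith [sq_nonneg R, sq_nonneg E]
        rcases le_max_iff.1 ih with h' | h'
        · refine le_max_of_le_left ?_
          rw [Finset.sum_range_succ]
          have e1 : 1 - T j / 2 ≤ Real.exp (-(T j / 2)) := by
            linarith [Real.add_one_le_exp (-(T j / 2))]
          calc (1 - T j / 2) * |x j| ≤ Real.exp (-(T j / 2)) *
              (|x 0| * Real.exp (-((∑ i ∈ Finset.range j, T i) / 2))) := by gcongr
            _ = |x 0| * (Real.exp (-((∑ i ∈ Finset.range j, T i) / 2)) * Real.exp (-(T j / 2))) := by ring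
            _ = _ := by rw [← Real.exp_add]; ring_nf
            _ ≤ _ := le_rfl
        · refine le_max_of_le_right ?_
          nlinarith [abs_nonneg (x j)]
      · refine le_max_of_le_right (h.trans ?_)
        linarith [hj j (by omega)]
  have hin : ∀ i, (⨆ (_ : i ∈ Finset.range k), |e i|) ≤ E := fun i =>
    Real.iSup_le (fun _ => he i) hE
  have hD0 : 0 ≤ ⨆ i, ⨆ (_ : i ∈ Finset.range k), |e i| :=
    Real.iSup_nonneg fun i => Real.iSup_nonneg fun _ => abs_nonneg _
  have hDE : (⨆ i, ⨆ (_ : i ∈ Finset.range k), |e i|) ≤ E := Real.iSup_le hin hE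
  have hle : ∀ i < k, |e i| ≤ ⨆ i, ⨆ (_ : i ∈ Finset.range k), |e i| := by
    intro i hi
    have := le_ciSup (f := fun i => ⨆ (_ : i ∈ Finset.range k), |e i|)
      ⟨E, by rintro _ ⟨i, rfl⟩; exact hin i⟩ i
    refine le_trans (le_of_eq ?_) this
    have hi' : i ∈ Finset.range k := Finset.mem_range.2 hi
    exact (ciSup_pos (f := fun _ => |e i|) hi').symm
  refine (key _ hD0 hDE k hle).trans (max_le_add_of_nonneg (by positivity) (by positivity))
end
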